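/- arXiv:2308.05885 — 8 statements merged into one kernel-verified Lean document; each statement's English description precedes it below -/
import Mathlib

section
/- Suppose θ(ζ₀) < ∞ and ∑_{ζ=ζ₀}^∞ ( (1/r(ζ)) ∑_{s=ζ₀}^{ζ−1} q(s) )^{1/α} = ∞. Then every solution {x(ζ)} of equation (1.1) either oscillates or satisfies lim_{ζ→∞} x(ζ) = 0. -/
open Filter Finset

/-- The real `n`-th root, extended to negative reals as an odd function
(this is the genuine real `n`-th root when `n` is odd). -/
noncomputable def oddRoot (n : ℕ) (t : ℝ) : ℝ :=
  if t < 0 then -((-t) ^ ((n : ℝ))⁻¹) else t ^ ((n : ℝ))⁻¹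

/-- `ratPow p n t` is the rational power `t ^ (p / n)`, defined for all real `t`
when the denominator `n` is odd. -/
noncomputable def ratPow (p : ℤ) (n : ℕ) (t : ℝ) : ℝ := oddRoot n t ^ p

/-- Forward difference operator: `fwd x ζ = x (ζ+1) - x ζ`. -/
def fwd (x : ℤ → ℝ) (ζ : ℤ) : ℝ := x (ζ + 1) - x ζ

/-- `theta α r ζ = ∑_{s=ζ}^∞ (r s) ^ (-1/α)`. -/
noncomputable def theta (α : ℝ) (r : ℤ → ℝ) (ζ : ℤ) : ℝ :=
  ∑' k : ℕ, (r (ζ + k) ^ α⁻¹)⁻¹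

/-- A real sequence is eventually positive. -/
def EvPos (x : ℤ → ℝ) : Prop := ∃ N : ℤ, ∀ ζ ≥ N, 0 < x ζ

/-- A real sequence is eventually negative. -/
def EvNeg (x : ℤ → ℝ) : Prop := ∃ N : ℤ, ∀ ζ ≥ N, x ζ < 0

/-- A sequence oscillates if it is neither eventually positive nor eventually negative. -/
def Oscillates (x : ℤ → ℝ) : Prop := ¬ EvPos x ∧ ¬ EvNeg x

lemma ratPow_natCast_neg {m n : ℕ} (hm : Odd m) (hn : 0 < n) (t : ℝ) :
    ratPow m n (-t) = -ratPow m n t := by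
  have hroot : oddRoot n (-t) = -oddRoot n t := by
    have hn' : ((n : ℝ))⁻¹ ≠ 0 := by positivity
    unfold oddRoot
    rcases lt_trichotomy t 0 with h | rfl | h
    · rw [if_neg (by linarith), if_pos h, neg_neg]
    · simp [Real.zero_rpow hn']
    · rw [if_pos (by linarith), if_neg (by linarith), neg_neg]
  simp only [ratPow, hroot, zpow_natCast, hm.neg_pow]

lemma ratPow_natCast_of_nonneg (m n : ℕ) {t : ℝ} (ht : 0 ≤ t) :
    ratPow m n t = t ^ ((m : ℝ) / n) := by
  rw [ratPow, oddRoot, if_neg ht.not_gt, zpow_natCast, ← Real.rpow_natCast, ← Real.rpow_mul ht,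
    inv_mul_eq_div]

lemma Int.le_of_forall_add_one_le {f : ℤ → ℝ} {N : ℤ} (hf : ∀ ζ ≥ N, f (ζ + 1) ≤ f ζ)
    {a b : ℤ} (ha : N ≤ a) (hab : a ≤ b) : f b ≤ f a := by
  induction b, hab using Int.leInduction with
  | base => exact le_rfl
  | succ k hk ih => exact (hf k (ha.trans hk)).trans ih

lemma Int.sum_Icc_eq_add_last (f : ℤ → ℝ) {a b : ℤ} (hab : a ≤ b) :
    ∑ s ∈ Icc a b, f s = ∑ s ∈ Icc a (b - 1), f s + f b := by
  have h : Icc a b = insert b (Icc a (b - 1)) := by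
    ext s
    simp only [mem_Icc, mem_insert]
    omega
  rw [h, sum_insert (by simp), add_comm]

lemma Int.sum_Icc_le_tsum {f : ℤ → ℝ} (hf : ∀ s, 0 ≤ f s) {a : ℤ}
    (hs : Summable fun k : ℕ => f (a + k)) {b : ℤ} (hab : a ≤ b) :
    ∑ s ∈ Icc a b, f s ≤ ∑' k : ℕ, f (a + k) := by
  have h : ∀ k : ℕ, ∑ s ∈ Icc a (a + k), f s = ∑ i ∈ Finset.range (k + 1), f (a + i) := by
    intro k
    induction k with
    | zero => simp
    | succ k ih =>
      rw [sum_range_succ, ← ih, Int.sum_Icc_eq_add_last f (by omega)]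
      push_cast
      rw [← add_assoc, add_sub_cancel_right]
  obtain ⟨k, rfl⟩ := Int.le.dest hab
  rw [h]
  exact hs.sum_le_tsum _ fun i _ => hf _

/-- The divergence condition forces the partial sums of `q` to be unbounded
when `r ^ (-1/α)` is summable. -/
lemma not_bddAbove_partialSums {α : ℝ} (hα : 0 < α) {ζ₀ : ℤ} {r q : ℤ → ℝ}
    (hr : ∀ ζ, 0 < r ζ) (hq : ∀ ζ, 0 ≤ q ζ)
    (hθ : Summable (fun k : ℕ => (r (ζ₀ + k) ^ α⁻¹)⁻¹))
    (hdiv : Tendsto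
      (fun N : ℤ => ∑ ζ ∈ Icc ζ₀ N, ((r ζ)⁻¹ * ∑ s ∈ Icc ζ₀ (ζ - 1), q s) ^ α⁻¹)
      atTop atTop) (Q : ℝ) :
    ∃ ζ ≥ ζ₀, Q < ∑ s ∈ Icc ζ₀ (ζ - 1), q s := by
  by_contra! hQ
  have hQ0 : 0 ≤ Q := by simpa using hQ ζ₀ le_rfl
  have hα' : 0 ≤ α⁻¹ := by positivity
  obtain ⟨N, hN, hN'⟩ := ((hdiv.eventually_gt_atTop
    (Q ^ α⁻¹ * ∑' k : ℕ, (r (ζ₀ + k) ^ α⁻¹)⁻¹)).and (eventually_ge_atTop ζ₀)).exists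
  refine hN.not_ge ?_
  calc ∑ ζ ∈ Icc ζ₀ N, ((r ζ)⁻¹ * ∑ s ∈ Icc ζ₀ (ζ - 1), q s) ^ α⁻¹
      ≤ ∑ ζ ∈ Icc ζ₀ N, Q ^ α⁻¹ * (r ζ ^ α⁻¹)⁻¹ := by
        refine sum_le_sum fun ζ hζ => ?_
        have hS : 0 ≤ ∑ s ∈ Icc ζ₀ (ζ - 1), q s := sum_nonneg fun s _ => hq s
        have hri : 0 ≤ (r ζ)⁻¹ := (inv_pos.2 (hr ζ)).le
        rw [Real.mul_rpow hri hS, Real.inv_rpow (hr ζ).le, mul_comm]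
        have := (hr ζ).le
        gcongr
        exact hQ ζ (mem_Icc.1 hζ).1
    _ = Q ^ α⁻¹ * ∑ ζ ∈ Icc ζ₀ N, (r ζ ^ α⁻¹)⁻¹ := (mul_sum ..).symm
    _ ≤ _ := by
        gcongr
        exact Int.sum_Icc_le_tsum (f := fun s => (r s ^ α⁻¹)⁻¹)
          (fun s => by have := (hr s).le; positivity) hθ hN'

section Core

variable {α : ℝ} {φ : ℝ → ℝ} {ζ₀ σ : ℤ} {r q x : ℤ → ℝ}

/-- A solution with oddly extended power `φ` cannot be eventually bounded below
by a positive constant. -/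
lemma not_eventually_ge_of_solution (hα : 0 < α)
    (hφ : ∀ t, 0 ≤ t → φ t = t ^ α) (hφ_neg : ∀ t, φ (-t) = -φ t)
    (hr : ∀ ζ, 0 < r ζ) (hq : ∀ ζ, 0 ≤ q ζ)
    (hθ : Summable (fun k : ℕ => (r (ζ₀ + k) ^ α⁻¹)⁻¹))
    (hdiv : Tendsto
      (fun N : ℤ => ∑ ζ ∈ Icc ζ₀ N, ((r ζ)⁻¹ * ∑ s ∈ Icc ζ₀ (ζ - 1), q s) ^ α⁻¹)
      atTop atTop)
    (hsol : ∀ ζ ≥ ζ₀, fwd (fun t => r t * φ (fwd x t)) ζ + q ζ * φ (x (ζ - σ)) = 0)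
    {c : ℝ} (hc : 0 < c) (N : ℤ) : ¬ ∀ ζ ≥ N, c ≤ x ζ := by
  intro hx
  set S : ℤ → ℝ := fun ζ => ∑ s ∈ Icc ζ₀ (ζ - 1), q s with hSdef
  set T : ℤ → ℝ := fun N => ∑ ζ ∈ Icc ζ₀ N, ((r ζ)⁻¹ * S ζ) ^ α⁻¹
  set y : ℤ → ℝ := fun t => r t * φ (fwd x t) with hydef
  have hS1 : ∀ ζ ≥ ζ₀, S (ζ + 1) = S ζ + q ζ := fun ζ hζ => by
    simp only [hSdef, add_sub_cancel_right]
    exact Int.sum_Icc_eq_add_last q hζ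
  have hcα : 0 < c ^ α := Real.rpow_pos_of_pos hc α
  set M := max ζ₀ (N + σ)
  have hanti : ∀ ζ ≥ M, y (ζ + 1) + c ^ α * S (ζ + 1) ≤ y ζ + c ^ α * S ζ := by
    intro ζ hζ
    have h1 : ζ₀ ≤ ζ := (le_max_left _ _).trans hζ
    have h2 : N + σ ≤ ζ := (le_max_right _ _).trans hζ
    have hxc := hx (ζ - σ) (by omega)
    have hpow : c ^ α ≤ φ (x (ζ - σ)) := by
      rw [hφ _ (hc.le.trans hxc)]
      gcongr
    have hs : y (ζ + 1) - y ζ + q ζ * φ (x (ζ - σ)) = 0 := hsol ζ h1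
    rw [hS1 ζ h1]
    nlinarith [mul_le_mul_of_nonneg_left hpow (hq ζ)]
  set K := y M + c ^ α * S M
  obtain ⟨P, hP, hPK⟩ :=
    not_bddAbove_partialSums hα hr hq hθ hdiv (max 0 (2 * K / c ^ α))
  set R := max M P
  have hy : ∀ ζ ≥ R, 0 < S ζ ∧ y ζ ≤ -(c ^ α / 2 * S ζ) := by
    intro ζ hζ
    have h1 : M ≤ ζ := (le_max_left _ _).trans hζ
    have hPζ : S P ≤ S ζ := sum_le_sum_of_subset_of_nonneg
      (Icc_subset_Icc le_rfl (by have : P ≤ ζ := (le_max_right _ _).trans hζ; omega))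
      fun s _ _ => hq s
    have hK : y ζ + c ^ α * S ζ ≤ K :=
      Int.le_of_forall_add_one_le (f := fun ζ => y ζ + c ^ α * S ζ) hanti le_rfl h1
    have h2 : 2 * K / c ^ α < S ζ := ((le_max_right _ _).trans_lt hPK).trans_le hPζ
    rw [div_lt_iff₀ hcα] at h2
    exact ⟨((le_max_left _ _).trans_lt hPK).trans_le hPζ, by nlinarith⟩
  set k := (c ^ α / 2) ^ α⁻¹
  have hk : 0 < k := by positivity
  have hdx : ∀ ζ ≥ R, x (ζ + 1) - x ζ ≤ -(k * ((r ζ)⁻¹ * S ζ) ^ α⁻¹) := by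
    intro ζ hζ
    obtain ⟨hSpos, hyζ⟩ := hy ζ hζ
    have hrζ := hr ζ
    have hA : 0 < c ^ α / 2 * S ζ := by positivity
    have hneg : fwd x ζ < 0 := by
      by_contra! h
      have : 0 ≤ y ζ := mul_nonneg hrζ.le (by rw [hφ _ h]; positivity)
      linarith
    have hφd : φ (fwd x ζ) = -(-fwd x ζ) ^ α := by
      rw [← hφ _ (by linarith), hφ_neg, neg_neg]
    have hd : c ^ α / 2 * ((r ζ)⁻¹ * S ζ) ≤ (-fwd x ζ) ^ α := by
      have : y ζ = -(r ζ * (-fwd x ζ) ^ α) := by rw [hydef]; simp only [hφd]; ring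
      have h3 : c ^ α / 2 * S ζ ≤ r ζ * (-fwd x ζ) ^ α := by linarith
      calc c ^ α / 2 * ((r ζ)⁻¹ * S ζ) = (c ^ α / 2 * S ζ) / r ζ := by ring
        _ ≤ _ := by rw [div_le_iff₀ hrζ]; linarith
    have h4 : k * ((r ζ)⁻¹ * S ζ) ^ α⁻¹ ≤ -fwd x ζ := by
      rw [← Real.mul_rpow (by positivity) (by positivity)]
      exact (Real.rpow_inv_le_iff_of_pos (by positivity) (by linarith) hα).2 hd
    have : fwd x ζ = x (ζ + 1) - x ζ := rfl
    linarith
  have hanti' : ∀ ζ ≥ R, x (ζ + 1) + k * T (ζ + 1 - 1) ≤ x ζ + k * T (ζ - 1) := by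
    intro ζ hζ
    have h1 : ζ₀ ≤ ζ := ((le_max_left _ _).trans (le_max_left _ _)).trans hζ
    have hT : T ζ = T (ζ - 1) + ((r ζ)⁻¹ * S ζ) ^ α⁻¹ := Int.sum_Icc_eq_add_last _ h1
    rw [add_sub_cancel_right, hT]
    linarith [hdx ζ hζ]
  obtain ⟨ζ, hζT, hζ⟩ := ((hdiv.eventually_gt_atTop ((x R + k * T (R - 1)) / k)).and
    (eventually_ge_atTop (max R N))).exists
  have hfin := Int.le_of_forall_add_one_le (f := fun ζ => x ζ + k * T (ζ - 1)) hanti' le_rfl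
    (show R ≤ ζ + 1 by have := (le_max_left R N).trans hζ; omega)
  have hxpos := hx (ζ + 1) (by have := (le_max_right R N).trans hζ; omega)
  change _ < T ζ at hζT
  rw [div_lt_iff₀ hk] at hζT
  simp only [add_sub_cancel_right] at hfin
  nlinarith

lemma tendsto_zero_of_evPos (hα : 0 < α)
    (hφ : ∀ t, 0 ≤ t → φ t = t ^ α) (hφ_neg : ∀ t, φ (-t) = -φ t)
    (hr : ∀ ζ, 0 < r ζ) (hq : ∀ ζ, 0 ≤ q ζ)
    (hθ : Summable (fun k : ℕ => (r (ζ₀ + k) ^ α⁻¹)⁻¹))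
    (hdiv : Tendsto
      (fun N : ℤ => ∑ ζ ∈ Icc ζ₀ N, ((r ζ)⁻¹ * ∑ s ∈ Icc ζ₀ (ζ - 1), q s) ^ α⁻¹)
      atTop atTop)
    (hsol : ∀ ζ ≥ ζ₀, fwd (fun t => r t * φ (fwd x t)) ζ + q ζ * φ (x (ζ - σ)) = 0)
    (hx : EvPos x) : Tendsto x atTop (nhds 0) := by
  obtain ⟨N, hN⟩ := hx
  have hnot : ∀ c > 0, ∀ M, ∃ ζ ≥ M, x ζ < c := fun c hc M => by
    simpa using not_eventually_ge_of_solution hα hφ hφ_neg hr hq hθ hdiv hsol hc M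
  set y : ℤ → ℝ := fun t => r t * φ (fwd x t)
  set M := max ζ₀ (N + σ)
  have hanti : ∀ ζ ≥ M, y (ζ + 1) ≤ y ζ := by
    intro ζ hζ
    have h1 : ζ₀ ≤ ζ := (le_max_left _ _).trans hζ
    have h2 : N + σ ≤ ζ := (le_max_right _ _).trans hζ
    have hxpos := hN (ζ - σ) (by omega)
    have hpow : 0 ≤ φ (x (ζ - σ)) := by
      rw [hφ _ hxpos.le]
      positivity
    have hs : y (ζ + 1) - y ζ + q ζ * φ (x (ζ - σ)) = 0 := hsol ζ h1
    linarith [mul_nonneg (hq ζ) hpow]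
  have hφ_pos : ∀ t, 0 < t → 0 < φ t := fun t ht => by
    rw [hφ t ht.le]
    positivity
  obtain ⟨P, hPM, hP⟩ : ∃ P ≥ M, y P < 0 := by
    by_contra! h
    have hmono : ∀ ζ ≥ M, -x (ζ + 1) ≤ -x ζ := by
      intro ζ hζ
      by_contra! hlt
      have h1 := hφ_pos (-fwd x ζ) (by unfold fwd; linarith)
      rw [hφ_neg] at h1
      exact (h ζ hζ).not_gt (mul_neg_of_pos_of_neg (hr ζ) (by linarith))
    obtain ⟨ζ, hζ, hlt⟩ := hnot (x (max M N)) (hN _ (le_max_right _ _)) (max M N)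
    have := Int.le_of_forall_add_one_le (f := fun ζ => -x ζ) hmono (le_max_left _ _) hζ
    linarith
  have hdecr : ∀ ζ ≥ P, x (ζ + 1) ≤ x ζ := by
    intro ζ hζ
    by_contra! hlt
    have h1 := mul_pos (hr ζ) (hφ_pos (fwd x ζ) (by unfold fwd; linarith))
    exact (((Int.le_of_forall_add_one_le hanti hPM hζ).trans_lt hP).trans h1).false
  refine Metric.tendsto_atTop.2 fun ε hε => ?_
  obtain ⟨Z, hZ, hlt⟩ := hnot ε hε (max P N)
  refine ⟨Z, fun ζ hζ => ?_⟩
  have hZP : P ≤ Z := (le_max_left _ _).trans hZ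
  have hZN : N ≤ Z := (le_max_right _ _).trans hZ
  rw [Real.dist_0_eq_abs, abs_of_pos (hN ζ (hZN.trans hζ))]
  exact (Int.le_of_forall_add_one_le hdecr hZP hζ).trans_lt hlt

end Core

/-- Theorem 2.1. Under the noncanonical condition `θ(ζ₀) < ∞` and
`∑_{ζ=ζ₀}^∞ ((1/r ζ) ∑_{s=ζ₀}^{ζ-1} q s)^{1/α} = ∞`, every solution of (1.1)
oscillates or tends to `0`. -/
theorem statement0
    (m n : ℕ) (α : ℝ) (hm : Odd m) (hn : Odd n) (hmn : Nat.Coprime m n)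
    (hm0 : 0 < m) (hn0 : 0 < n) (hα : α = (m : ℝ) / n)
    (ζ₀ σ : ℤ) (hσ : 0 ≤ σ)
    (r q : ℤ → ℝ) (hr : ∀ ζ, 0 < r ζ) (hq : ∀ ζ, 0 ≤ q ζ)
    (hq0 : ∀ N : ℤ, ∃ ζ ≥ N, q ζ ≠ 0)
    (hθ : Summable (fun k : ℕ => (r (ζ₀ + k) ^ α⁻¹)⁻¹))
    (hdiv : Tendsto
      (fun N : ℤ => ∑ ζ ∈ Finset.Icc ζ₀ N,
        ((r ζ)⁻¹ * ∑ s ∈ Finset.Icc ζ₀ (ζ - 1), q s) ^ α⁻¹)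
      atTop atTop)
    (x : ℤ → ℝ) (hnt : ∃ ζ, x ζ ≠ 0)
    (hsol : ∀ ζ ≥ ζ₀, fwd (fun t => r t * ratPow m n (fwd x t)) ζ
        + q ζ * ratPow m n (x (ζ - σ)) = 0) :
    Oscillates x ∨ Tendsto x atTop (nhds 0) := by
  have hα0 : 0 < α := by
    rw [hα]
    positivity
  have hφ : ∀ t, 0 ≤ t → ratPow m n t = t ^ α := fun t ht => by
    rw [hα, ratPow_natCast_of_nonneg m n ht]
  have hφ_neg := ratPow_natCast_neg hm hn0
  by_cases hpos : EvPos x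
  · exact .inr (tendsto_zero_of_evPos hα0 hφ hφ_neg hr hq hθ hdiv hsol hpos)
  by_cases hneg : EvNeg x
  · right
    obtain ⟨N, hN⟩ := hneg
    have hsol' : ∀ ζ ≥ ζ₀, fwd (fun t => r t * ratPow m n (fwd (-x) t)) ζ
        + q ζ * ratPow m n ((-x) (ζ - σ)) = 0 := by
      intro ζ hζ
      have hfwd : ∀ t, fwd (-x) t = -fwd x t := fun t => by
        simp only [fwd, Pi.neg_apply]
        ring
      have h := hsol ζ hζ
      simp only [hfwd, Pi.neg_apply, hφ_neg]
      simp only [fwd] at h ⊢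
      linarith
    have h := tendsto_zero_of_evPos hα0 hφ hφ_neg hr hq hθ hdiv hsol'
      ⟨N, fun ζ hζ => neg_pos.2 (hN ζ hζ)⟩
    simpa using h.neg
  · exact .inl ⟨hpos, hneg⟩
end

section
/- Suppose θ(ζ₀) < ∞ and at least one of the following two conditions holds: (i) ∑_{ζ=ζ₀}^∞ ( (1/r(ζ)) ∑_{s=ζ₀}^{ζ−1} q(s)·θ^α(s−σ) )^{1/α} = ∞, or (ii) ∑_{s=ζ₀}^∞ q(s)·θ^{α+1}(s+1) = ∞. Then every solution of equation (1.1) oscillates. -/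
open Filter Finset

/-! ### Rational powers with odd numerator and denominator -/

theorem ratPow_of_nonneg {m n : ℕ} {t : ℝ} (ht : 0 ≤ t) :
    ratPow m n t = t ^ ((m : ℝ) / n) := by
  rw [ratPow, oddRoot, if_neg ht.not_gt, zpow_natCast, ← Real.rpow_natCast, ← Real.rpow_mul ht]
  congr 1
  ring

theorem oddRoot_neg {n : ℕ} (hn : n ≠ 0) (t : ℝ) : oddRoot n (-t) = -oddRoot n t := by
  have hn' : ((n : ℝ))⁻¹ ≠ 0 := inv_ne_zero (Nat.cast_ne_zero.mpr hn)
  rcases lt_trichotomy t 0 with h | rfl | h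
  · simp [oddRoot, h, h.le.not_gt]
  · simp [oddRoot, Real.zero_rpow hn']
  · simp [oddRoot, h, h.le.not_gt]

theorem ratPow_neg {m n : ℕ} (hm : Odd m) (hn : n ≠ 0) (t : ℝ) :
    ratPow m n (-t) = -ratPow m n t := by
  rw [ratPow, ratPow, oddRoot_neg hn, zpow_natCast, zpow_natCast, hm.neg_pow]

theorem ratPow_of_nonpos {m n : ℕ} (hm : Odd m) (hn : n ≠ 0) {t : ℝ} (ht : t ≤ 0) :
    ratPow m n t = -(-t) ^ ((m : ℝ) / n) := by
  rw [← ratPow_of_nonneg (neg_nonneg.mpr ht), ratPow_neg hm hn, neg_neg]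

theorem fwd_neg (x : ℤ → ℝ) (ζ : ℤ) : fwd (fun t => -x t) ζ = -fwd x ζ := by
  simp only [fwd]
  ring

/-! ### Sequences indexed by the integers -/

theorem le_of_forall_succ_le {f : ℤ → ℝ} {M : ℤ} (h : ∀ s ≥ M, f (s + 1) ≤ f s)
    {s u : ℤ} (hs : M ≤ s) (hu : s ≤ u) : f u ≤ f s := by
  obtain ⟨j, rfl⟩ := Int.le.dest hu
  clear hu
  induction j with
  | zero => simp
  | succ k ih =>
    refine le_trans ?_ ih
    rw [Nat.cast_succ, ← add_assoc]
    exact h _ (by omega)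

theorem sum_Icc_succ_top_int (f : ℤ → ℝ) {a b : ℤ} (h : a ≤ b + 1) :
    ∑ s ∈ Finset.Icc a (b + 1), f s = ∑ s ∈ Finset.Icc a b, f s + f (b + 1) := by
  have : Finset.Icc a (b + 1) = insert (b + 1) (Finset.Icc a b) := by
    ext
    simp only [Finset.mem_insert, Finset.mem_Icc]
    omega
  rw [this, Finset.sum_insert (by simp), add_comm]

/-- A series whose terms are eventually dominated by the increments of a sequence bounded above
does not diverge to `+∞`. -/
theorem not_tendsto_sum_of_le_sub {f F : ℤ → ℝ} {a M : ℤ} {B : ℝ}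
    (hf : ∀ s ≥ M, f s ≤ F (s + 1) - F s) (hF : ∀ s ≥ M, F s ≤ B) :
    ¬ Tendsto (fun N : ℤ => ∑ s ∈ Finset.Icc a N, f s) atTop atTop := by
  intro h
  set K := max M a
  have hKM : M ≤ K := le_max_left _ _
  have hKa : a ≤ K := le_max_right _ _
  have hstep : ∀ N ≥ K, ∑ s ∈ Finset.Icc a (N + 1), f s - F (N + 1 + 1) ≤
      ∑ s ∈ Finset.Icc a N, f s - F (N + 1) := by
    intro N hN
    rw [sum_Icc_succ_top_int f (by omega)]
    linarith [hf (N + 1) (by omega)]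
  obtain ⟨N, hN, hNK⟩ := ((h.eventually_gt_atTop
    (∑ s ∈ Finset.Icc a K, f s - F (K + 1) + B)).and (eventually_ge_atTop K)).exists
  have h1 := le_of_forall_succ_le (f := fun N => ∑ s ∈ Finset.Icc a N, f s - F (N + 1))
    hstep le_rfl hNK
  have h2 := hF (N + 1) (by omega)
  linarith

/-! ### The tail sums `theta` -/

theorem summable_shift_int {t : ℤ → ℝ} {a : ℤ} (h : Summable fun k : ℕ => t (a + k)) (b : ℤ) :
    Summable fun k : ℕ => t (b + k) := by
  rcases le_total a b with hab | hab
  · obtain ⟨j, rfl⟩ := Int.le.dest hab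
    refine ((summable_nat_add_iff j).mpr h).congr fun k => ?_
    congr 1
    push_cast
    ring
  · obtain ⟨j, rfl⟩ := Int.le.dest hab
    refine (summable_nat_add_iff j).mp (h.congr fun k => ?_)
    congr 1
    push_cast
    ring

section Theta

variable {α : ℝ} {r : ℤ → ℝ}

theorem theta_eq_add (hs : ∀ b : ℤ, Summable fun k : ℕ => (r (b + k) ^ α⁻¹)⁻¹) (ζ : ℤ) :
    theta α r ζ = (r ζ ^ α⁻¹)⁻¹ + theta α r (ζ + 1) := by
  rw [theta, (hs ζ).tsum_eq_zero_add, theta]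
  simp only [Nat.cast_zero, add_zero, Nat.cast_add, Nat.cast_one, add_assoc, add_comm (1 : ℤ)]

theorem theta_nonneg (hr : ∀ ζ, 0 < r ζ) (ζ : ℤ) : 0 ≤ theta α r ζ :=
  tsum_nonneg fun _ => inv_nonneg.mpr (Real.rpow_nonneg (hr _).le _)

theorem theta_pos (hr : ∀ ζ, 0 < r ζ)
    (hs : ∀ b : ℤ, Summable fun k : ℕ => (r (b + k) ^ α⁻¹)⁻¹) (ζ : ℤ) : 0 < theta α r ζ := by
  rw [theta_eq_add hs]
  exact add_pos_of_pos_of_nonneg (inv_pos.mpr (Real.rpow_pos_of_pos (hr _) _)) (theta_nonneg hr _)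

theorem theta_anti (hr : ∀ ζ, 0 < r ζ)
    (hs : ∀ b : ℤ, Summable fun k : ℕ => (r (b + k) ^ α⁻¹)⁻¹) {a b : ℤ} (hab : a ≤ b) :
    theta α r b ≤ theta α r a := by
  refine le_of_forall_succ_le (M := a) (fun s _ => ?_) le_rfl hab
  rw [theta_eq_add hs s]
  exact le_add_of_nonneg_left (inv_nonneg.mpr (Real.rpow_nonneg (hr _).le _))

/-- The two divergence conditions of the oscillation criterion. -/
def DivergenceCondition (α : ℝ) (ζ₀ σ : ℤ) (r q : ℤ → ℝ) : Prop :=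
  Tendsto
    (fun N : ℤ => ∑ ζ ∈ Finset.Icc ζ₀ N,
      ((r ζ)⁻¹ * ∑ s ∈ Finset.Icc ζ₀ (ζ - 1), q s * theta α r (s - σ) ^ α) ^ α⁻¹)
    atTop atTop
  ∨ Tendsto
      (fun N : ℤ => ∑ s ∈ Finset.Icc ζ₀ N, q s * theta α r (s + 1) ^ (α + 1))
      atTop atTop

theorem rpow_add_one_sub_le {a b : ℝ} (hα : 0 < α) (ha : 0 < a) (hb : 0 ≤ b) :
    a ^ (α + 1) - b ^ (α + 1) ≤ (α + 1) * a ^ α * (a - b) := by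
  have h := one_add_mul_self_le_rpow_one_add (s := b / a - 1) (p := α + 1)
    (by linarith [div_nonneg hb ha.le]) (by linarith)
  rw [add_sub_cancel, Real.div_rpow hb ha.le, le_div_iff₀ (Real.rpow_pos_of_pos ha _)] at h
  have e : a ^ (α + 1) = a ^ α * a := by rw [Real.rpow_add ha, Real.rpow_one]
  have e2 : (1 + (α + 1) * (b / a - 1)) * a ^ (α + 1)
      = a ^ (α + 1) - (α + 1) * a ^ α * (a - b) := by
    rw [e]
    field_simp
    ring
  linarith

/-! ### Positive solutions -/

variable {ζ₀ σ M : ℤ} {q x y z : ℤ → ℝ}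

/-- Under the divergence condition there is no eventually positive nondecreasing solution. -/
theorem not_divergenceCondition_of_increasing (hα : 0 < α) (hσ : 0 ≤ σ) (hr : ∀ ζ, 0 < r ζ)
    (hq : ∀ ζ, 0 ≤ q ζ) (hs : ∀ b : ℤ, Summable fun k : ℕ => (r (b + k) ^ α⁻¹)⁻¹)
    (hx : 0 < x M) (hxm : ∀ ζ ≥ M, x ζ ≤ x (ζ + 1)) (hy : ∀ ζ ≥ M, 0 ≤ y ζ)
    (hyx : ∀ ζ ≥ M, y ζ - y (ζ + 1) = q ζ * x (ζ - σ) ^ α) :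
    ¬ DivergenceCondition α ζ₀ σ r q := by
  have hxM : ∀ ζ ≥ M, x M ≤ x ζ := fun ζ hζ => by
    have := le_of_forall_succ_le (f := fun s => -x s) (fun s hs => neg_le_neg (hxm s hs)) le_rfl hζ
    simpa using this
  have hc : 0 < x M ^ α := Real.rpow_pos_of_pos hx α
  have hqy : ∀ ζ ≥ M + σ, q ζ * x M ^ α ≤ y ζ - y (ζ + 1) := fun ζ hζ => by
    rw [hyx ζ (by omega)]
    exact mul_le_mul_of_nonneg_left
      (Real.rpow_le_rpow hx.le (hxM _ (by omega)) hα.le) (hq ζ)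
  have hqA : ∀ A ≥ 0, ∀ ζ ≥ M + σ, q ζ * A ≤ A / x M ^ α * (y ζ - y (ζ + 1)) := by
    intro A hA ζ hζ
    calc q ζ * A = A / x M ^ α * (q ζ * x M ^ α) := by field_simp
      _ ≤ _ := mul_le_mul_of_nonneg_left (hqy ζ hζ) (by positivity)
  rintro (h | h)
  · set S : ℤ → ℝ := fun ζ => ∑ s ∈ Finset.Icc ζ₀ (ζ - 1), q s * theta α r (s - σ) ^ α with hS
    set K := max (M + σ) ζ₀
    have hKM : M + σ ≤ K := le_max_left _ _
    have hKa : ζ₀ ≤ K := le_max_right _ _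
    set A := theta α r (K - σ) ^ α
    have hA : 0 ≤ A := Real.rpow_nonneg (theta_nonneg hr _) _
    have hstep : ∀ ζ ≥ K, S (ζ + 1) + A / x M ^ α * y (ζ + 1) ≤ S ζ + A / x M ^ α * y ζ := by
      intro ζ hζ
      have e : S (ζ + 1) = S ζ + q ζ * theta α r (ζ - σ) ^ α := by
        have := sum_Icc_succ_top_int (fun s => q s * theta α r (s - σ) ^ α) (a := ζ₀)
          (b := ζ - 1) (by omega)
        simpa [hS] using this
      have h1 : q ζ * theta α r (ζ - σ) ^ α ≤ q ζ * A :=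
        mul_le_mul_of_nonneg_left (Real.rpow_le_rpow (theta_nonneg hr _)
          (theta_anti hr hs (by omega)) hα.le) (hq ζ)
      have h2 := hqA A hA ζ (by omega)
      rw [e]
      linarith
    set C := S K + A / x M ^ α * y K
    have hSC : ∀ ζ ≥ K, S ζ ≤ C := fun ζ hζ => by
      have h1 := le_of_forall_succ_le (f := fun ζ => S ζ + A / x M ^ α * y ζ) hstep le_rfl hζ
      have h2 : 0 ≤ A / x M ^ α * y ζ := mul_nonneg (by positivity) (hy ζ (by omega))
      linarith
    have hS0 : ∀ ζ, 0 ≤ S ζ := fun ζ =>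
      Finset.sum_nonneg fun s _ => mul_nonneg (hq s) (Real.rpow_nonneg (theta_nonneg hr _) _)
    refine not_tendsto_sum_of_le_sub (M := K) (F := fun ζ => -(C ^ α⁻¹ * theta α r ζ)) (B := 0)
      (fun ζ hζ => ?_) (fun ζ hζ => ?_) h
    · have h1 : ((r ζ)⁻¹ * S ζ) ^ α⁻¹ ≤ (r ζ ^ α⁻¹)⁻¹ * C ^ α⁻¹ := by
        rw [Real.mul_rpow (inv_nonneg.mpr (hr ζ).le) (hS0 ζ), Real.inv_rpow (hr ζ).le]
        exact mul_le_mul_of_nonneg_left (Real.rpow_le_rpow (hS0 ζ) (hSC ζ hζ)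
          (inv_nonneg.mpr hα.le)) (inv_nonneg.mpr (Real.rpow_nonneg (hr _).le _))
      have h2 : theta α r ζ - theta α r (ζ + 1) = (r ζ ^ α⁻¹)⁻¹ := by
        rw [theta_eq_add hs ζ]
        ring
      rw [← h2] at h1
      linarith
    · have := mul_nonneg (Real.rpow_nonneg ((hS0 K).trans (hSC K le_rfl)) α⁻¹)
        (theta_nonneg (α := α) hr ζ)
      linarith
  · set A := theta α r (M + σ) ^ (α + 1)
    have hA : 0 ≤ A := Real.rpow_nonneg (theta_nonneg hr _) _
    refine not_tendsto_sum_of_le_sub (M := M + σ) (F := fun ζ => -(A / x M ^ α * y ζ)) (B := 0)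
      (fun ζ hζ => ?_) (fun ζ hζ => ?_) h
    · have h1 : q ζ * theta α r (ζ + 1) ^ (α + 1) ≤ q ζ * A :=
        mul_le_mul_of_nonneg_left (Real.rpow_le_rpow (theta_nonneg hr _)
          (theta_anti hr hs (by omega)) (by linarith)) (hq ζ)
      linarith [hqA A hA ζ hζ]
    · have : 0 ≤ A / x M ^ α * y ζ := mul_nonneg (by positivity) (hy ζ (by omega))
      linarith

/-- A positive decreasing solution dominates its quasi-difference times `theta`. -/
theorem rpow_inv_mul_theta_le (hα : 0 < α) (hr : ∀ ζ, 0 < r ζ)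
    (hx : ∀ ζ ≥ M, 0 < x ζ) (hxm : ∀ ζ ≥ M, x (ζ + 1) ≤ x ζ)
    (hzx : ∀ ζ ≥ M, z ζ = r ζ * (x ζ - x (ζ + 1)) ^ α)
    (hz : ∀ ζ ≥ M, 0 < z ζ) (hzm : ∀ ζ ≥ M, z ζ ≤ z (ζ + 1)) {ζ : ℤ} (hζ : M ≤ ζ) :
    z ζ ^ α⁻¹ * theta α r ζ ≤ x ζ := by
  have hd : ∀ s ≥ ζ, z ζ ^ α⁻¹ * (r s ^ α⁻¹)⁻¹ ≤ x s - x (s + 1) := by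
    intro s hs
    have hzs : z ζ ≤ z s := by
      have := le_of_forall_succ_le (f := fun s => -z s) (fun s hs => neg_le_neg (hzm s hs)) hζ hs
      simpa using this
    have hx0 : 0 ≤ x s - x (s + 1) := sub_nonneg.mpr (hxm s (by omega))
    have e : x s - x (s + 1) = z s ^ α⁻¹ * (r s ^ α⁻¹)⁻¹ := by
      rw [hzx s (by omega), Real.mul_rpow (hr s).le (Real.rpow_nonneg hx0 _),
        Real.rpow_rpow_inv hx0 hα.ne']
      rw [mul_right_comm, mul_inv_cancel₀ (Real.rpow_pos_of_pos (hr s) _).ne', one_mul]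
    rw [e]
    exact mul_le_mul_of_nonneg_right (Real.rpow_le_rpow (hz ζ hζ).le hzs (inv_nonneg.mpr hα.le))
      (inv_nonneg.mpr (Real.rpow_nonneg (hr _).le _))
  rw [theta, ← tsum_mul_left]
  refine Real.tsum_le_of_sum_range_le (fun k => mul_nonneg (Real.rpow_nonneg (hz ζ hζ).le _)
    (inv_nonneg.mpr (Real.rpow_nonneg (hr _).le _))) fun j => ?_
  have h1 : ∑ i ∈ Finset.range j, z ζ ^ α⁻¹ * (r (ζ + i) ^ α⁻¹)⁻¹ ≤
      ∑ i ∈ Finset.range j, (x (ζ + i) - x (ζ + (i + 1 : ℕ))) :=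
    Finset.sum_le_sum fun i _ => by
      have := hd (ζ + i) (by omega)
      rwa [add_assoc] at this
  rw [Finset.sum_range_sub' (fun i : ℕ => x (ζ + i))] at h1
  have h2 := hx (ζ + j) (by omega)
  simp only [Nat.cast_zero, add_zero] at h1
  linarith

/-- Under the divergence condition there is no eventually positive decreasing solution. -/
theorem not_divergenceCondition_of_decreasing (hα : 0 < α) (hσ : 0 ≤ σ) (hr : ∀ ζ, 0 < r ζ)
    (hq : ∀ ζ, 0 ≤ q ζ) (hs : ∀ b : ℤ, Summable fun k : ℕ => (r (b + k) ^ α⁻¹)⁻¹)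
    (hx : ∀ ζ ≥ M, 0 < x ζ) (hxm : ∀ ζ ≥ M, x (ζ + 1) ≤ x ζ)
    (hzx : ∀ ζ ≥ M, z ζ = r ζ * (x ζ - x (ζ + 1)) ^ α) (hz : ∀ ζ ≥ M, 0 < z ζ)
    (hzq : ∀ ζ ≥ M + σ, z (ζ + 1) = z ζ + q ζ * x (ζ - σ) ^ α) :
    ¬ DivergenceCondition α ζ₀ σ r q := by
  set L := M + σ
  have hzm : ∀ ζ ≥ L, z ζ ≤ z (ζ + 1) := fun ζ hζ => by
    rw [hzq ζ hζ]
    exact le_add_of_nonneg_right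
      (mul_nonneg (hq ζ) (Real.rpow_nonneg (hx _ (by omega)).le _))
  have hxθ : ∀ ζ ≥ L, z ζ ^ α⁻¹ * theta α r ζ ≤ x ζ := fun ζ hζ =>
    rpow_inv_mul_theta_le hα hr (fun s hs => hx s (by omega)) (fun s hs => hxm s (by omega))
      (fun s hs => hzx s (by omega)) (fun s hs => hz s (by omega)) hzm hζ
  have hzθ : ∀ ζ ≥ L, z ζ * theta α r ζ ^ α ≤ x ζ ^ α := fun ζ hζ => by
    have hz0 := (hz ζ (by omega)).le
    have h := Real.rpow_le_rpow (mul_nonneg (Real.rpow_nonneg hz0 _) (theta_nonneg hr _))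
      (hxθ ζ hζ) hα.le
    rwa [Real.mul_rpow (Real.rpow_nonneg hz0 _) (theta_nonneg hr _),
      Real.rpow_inv_rpow hz0 hα.ne'] at h
  rintro (h | h)
  · set S : ℤ → ℝ := fun ζ => ∑ s ∈ Finset.Icc ζ₀ (ζ - 1), q s * theta α r (s - σ) ^ α with hS
    have hS0 : ∀ ζ, 0 ≤ S ζ := fun ζ =>
      Finset.sum_nonneg fun s _ => mul_nonneg (hq s) (Real.rpow_nonneg (theta_nonneg hr _) _)
    set K := max (L + σ) ζ₀
    have hKM : L + σ ≤ K := le_max_left _ _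
    have hKa : ζ₀ ≤ K := le_max_right _ _
    have hzL : 0 < z L := hz L (by omega)
    have hzK : 0 < z K := hz K (by omega)
    obtain ⟨c, hc, hcL, hcK⟩ : ∃ c > 0, c ≤ z L ∧ c * S K ≤ z K := by
      refine ⟨min (z L) (z K / (S K + 1)), lt_min hzL (by have := hS0 K; positivity),
        min_le_left _ _, ?_⟩
      have h1 : 0 < S K + 1 := by linarith [hS0 K]
      calc min (z L) (z K / (S K + 1)) * S K ≤ z K / (S K + 1) * S K :=
            mul_le_mul_of_nonneg_right (min_le_right _ _) (hS0 K)
        _ ≤ z K / (S K + 1) * (S K + 1) :=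
            mul_le_mul_of_nonneg_left (by linarith) (by positivity)
        _ = z K := by field_simp
    have hstep : ∀ ζ ≥ K, c * S (ζ + 1) - z (ζ + 1) ≤ c * S ζ - z ζ := by
      intro ζ hζ
      have e : S (ζ + 1) = S ζ + q ζ * theta α r (ζ - σ) ^ α := by
        have := sum_Icc_succ_top_int (fun s => q s * theta α r (s - σ) ^ α) (a := ζ₀)
          (b := ζ - 1) (by omega)
        simpa [hS] using this
      have hcz : c ≤ z (ζ - σ) := hcL.trans <| by
        have := le_of_forall_succ_le (f := fun s => -z s) (fun s hs => neg_le_neg (hzm s hs))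
          le_rfl (show L ≤ ζ - σ by omega)
        simpa using this
      have h1 : c * theta α r (ζ - σ) ^ α ≤ x (ζ - σ) ^ α :=
        (mul_le_mul_of_nonneg_right hcz (Real.rpow_nonneg (theta_nonneg hr _) _)).trans
          (hzθ _ (by omega))
      have h2 := mul_le_mul_of_nonneg_left h1 (hq ζ)
      rw [e, hzq ζ (by omega)]
      linarith
    have hSz : ∀ ζ ≥ K, c * S ζ ≤ z ζ := fun ζ hζ => by
      have h1 := le_of_forall_succ_le (f := fun ζ => c * S ζ - z ζ) hstep le_rfl hζ
      linarith
    have hcα : 0 < c ^ α⁻¹ := Real.rpow_pos_of_pos hc _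
    refine not_tendsto_sum_of_le_sub (M := K) (F := fun ζ => -(x ζ / c ^ α⁻¹)) (B := 0)
      (fun ζ hζ => ?_) (fun ζ hζ => ?_) h
    · have hx0 : 0 ≤ x ζ - x (ζ + 1) := sub_nonneg.mpr (hxm ζ (by omega))
      have hr0 := hr ζ
      have h1 : c * ((r ζ)⁻¹ * S ζ) ≤ (x ζ - x (ζ + 1)) ^ α := by
        have h2 := hSz ζ hζ
        rw [hzx ζ (by omega)] at h2
        calc c * ((r ζ)⁻¹ * S ζ) = (r ζ)⁻¹ * (c * S ζ) := by ring
          _ ≤ (r ζ)⁻¹ * (r ζ * (x ζ - x (ζ + 1)) ^ α) :=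
              mul_le_mul_of_nonneg_left h2 (inv_nonneg.mpr hr0.le)
          _ = _ := by field_simp
      have hrS : 0 ≤ (r ζ)⁻¹ * S ζ := mul_nonneg (inv_nonneg.mpr hr0.le) (hS0 ζ)
      have h3 := Real.rpow_le_rpow (mul_nonneg hc.le hrS) h1 (inv_nonneg.mpr hα.le)
      rw [Real.mul_rpow hc.le hrS, Real.rpow_rpow_inv hx0 hα.ne'] at h3
      have h4 : ((r ζ)⁻¹ * S ζ) ^ α⁻¹ ≤ (x ζ - x (ζ + 1)) / c ^ α⁻¹ := by
        rw [le_div_iff₀ hcα]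
        linarith
      rw [sub_div] at h4
      linarith
    · have : 0 < x ζ / c ^ α⁻¹ := div_pos (hx ζ (by omega)) hcα
      linarith
  · set w : ℤ → ℝ := fun ζ => z ζ / x ζ ^ α with hw
    have hxα : ∀ ζ ≥ M, 0 < x ζ ^ α := fun ζ hζ => Real.rpow_pos_of_pos (hx ζ hζ) _
    have hw0 : ∀ ζ ≥ L, 0 ≤ w ζ := fun ζ hζ =>
      (div_pos (hz ζ (by omega)) (hxα ζ (by omega))).le
    have hwθ : ∀ ζ ≥ L, w ζ * theta α r ζ ^ α ≤ 1 := fun ζ hζ => by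
      rw [hw, div_mul_eq_mul_div, div_le_one (hxα ζ (by omega))]
      exact hzθ ζ hζ
    have hwq : ∀ ζ ≥ L, q ζ ≤ w (ζ + 1) - w ζ := by
      intro ζ hζ
      have hp := hxα (ζ + 1) (by omega)
      have h1 : x (ζ + 1) ^ α ≤ x (ζ - σ) ^ α :=
        Real.rpow_le_rpow (hx _ (by omega)).le
          (le_of_forall_succ_le hxm (by omega) (by omega)) hα.le
      have h2 : x (ζ + 1) ^ α ≤ x ζ ^ α :=
        Real.rpow_le_rpow (hx _ (by omega)).le (hxm ζ (by omega)) hα.le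
      have h3 : z ζ / x ζ ^ α ≤ z ζ / x (ζ + 1) ^ α :=
        div_le_div_of_nonneg_left (hz ζ (by omega)).le hp h2
      have h4 : q ζ ≤ q ζ * x (ζ - σ) ^ α / x (ζ + 1) ^ α := by
        rw [le_div_iff₀ hp]
        exact mul_le_mul_of_nonneg_left h1 (hq ζ)
      simp only [hw]
      rw [hzq ζ hζ, add_div]
      linarith
    refine not_tendsto_sum_of_le_sub (M := L)
      (F := fun ζ => w ζ * theta α r ζ ^ (α + 1) - (α + 1) * theta α r ζ)
      (B := theta α r L) (fun ζ hζ => ?_) (fun ζ hζ => ?_) h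
    · have hθ0 := theta_nonneg (α := α) hr (ζ + 1)
      have h1 := mul_le_mul_of_nonneg_right (hwq ζ hζ) (Real.rpow_nonneg hθ0 (α + 1))
      have h2 := mul_le_mul_of_nonneg_left
        (rpow_add_one_sub_le hα (theta_pos hr hs ζ) hθ0) (hw0 ζ hζ)
      have h3 : (w ζ * theta α r ζ ^ α) * ((α + 1) * (theta α r ζ - theta α r (ζ + 1))) ≤
          1 * ((α + 1) * (theta α r ζ - theta α r (ζ + 1))) :=
        mul_le_mul_of_nonneg_right (hwθ ζ hζ) (mul_nonneg (by linarith)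
          (sub_nonneg.mpr (theta_anti hr hs (by omega))))
      linarith
    · have hθp := theta_pos hr hs ζ
      have h1 := mul_le_mul_of_nonneg_right (hwθ ζ hζ) hθp.le
      have h2 := theta_anti hr hs hζ
      have h3 : 0 ≤ (α + 1) * theta α r ζ := by positivity
      rw [Real.rpow_add hθp, Real.rpow_one]
      linarith

end Theta

theorem not_evPos_of_divergenceCondition {m n : ℕ} {α : ℝ} (hm : Odd m) (hn : n ≠ 0)
    (hα : α = (m : ℝ) / n) {ζ₀ σ : ℤ} (hσ : 0 ≤ σ) {r q : ℤ → ℝ} (hr : ∀ ζ, 0 < r ζ)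
    (hq : ∀ ζ, 0 ≤ q ζ) (hθ : Summable (fun k : ℕ => (r (ζ₀ + k) ^ α⁻¹)⁻¹))
    (hcond : DivergenceCondition α ζ₀ σ r q) {x : ℤ → ℝ}
    (hsol : ∀ ζ ≥ ζ₀, fwd (fun t => r t * ratPow m n (fwd x t)) ζ
        + q ζ * ratPow m n (x (ζ - σ)) = 0) :
    ¬ EvPos x := by
  rintro ⟨N, hN⟩
  have hα0 : 0 < α := by
    rw [hα]
    exact div_pos (Nat.cast_pos.mpr hm.pos) (Nat.cast_pos.mpr (Nat.pos_of_ne_zero hn))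
  have hs := summable_shift_int (t := fun s => (r s ^ α⁻¹)⁻¹) hθ
  set y : ℤ → ℝ := fun t => r t * ratPow m n (fwd x t) with hy
  set M := max (N + σ) ζ₀
  have hM1 : N + σ ≤ M := le_max_left _ _
  have hM2 : ζ₀ ≤ M := le_max_right _ _
  have hyx : ∀ ζ ≥ M, y ζ - y (ζ + 1) = q ζ * x (ζ - σ) ^ α := by
    intro ζ hζ
    have h := hsol ζ (by omega)
    rw [ratPow_of_nonneg (hN (ζ - σ) (by omega)).le, ← hα] at h
    rw [fwd] at h
    linarith
  have hya : ∀ ζ ≥ M, y (ζ + 1) ≤ y ζ := fun ζ hζ => by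
    have := mul_nonneg (hq ζ) (Real.rpow_nonneg (hN (ζ - σ) (by omega)).le α)
    linarith [hyx ζ hζ]
  by_cases hneg : ∃ K ≥ M, y K < 0
  · obtain ⟨K, hK, hyK⟩ := hneg
    have hyneg : ∀ ζ ≥ K, y ζ < 0 := fun ζ hζ =>
      (le_of_forall_succ_le hya hK hζ).trans_lt hyK
    have hfwd : ∀ ζ ≥ K, fwd x ζ ≤ 0 := by
      intro ζ hζ
      by_contra! hpos
      refine (hyneg ζ hζ).not_ge (mul_nonneg (hr ζ).le ?_)
      rw [ratPow_of_nonneg hpos.le]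
      exact Real.rpow_nonneg hpos.le _
    refine not_divergenceCondition_of_decreasing (M := K) (x := x) (z := fun ζ => -y ζ) hα0 hσ hr
      hq hs (fun ζ hζ => hN ζ (by omega)) (fun ζ hζ => ?_) (fun ζ hζ => ?_)
      (fun ζ hζ => neg_pos.mpr (hyneg ζ hζ)) (fun ζ hζ => ?_) hcond
    · have := hfwd ζ hζ
      rw [fwd] at this
      linarith
    · simp only [hy]
      rw [ratPow_of_nonpos hm hn (hfwd ζ hζ), ← hα, fwd, neg_sub]
      ring
    · have := hyx ζ (by omega)
      linarith
  · push Not at hneg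
    refine not_divergenceCondition_of_increasing (M := M) (x := x) (y := y) hα0 hσ hr hq hs
      (hN M (by omega)) (fun ζ hζ => ?_) hneg hyx hcond
    by_contra! hlt
    have hlt' : fwd x ζ < 0 := by
      rw [fwd]
      linarith
    refine (hneg ζ hζ).not_gt (mul_neg_of_pos_of_neg (hr ζ) ?_)
    rw [ratPow_of_nonpos hm hn hlt'.le, neg_lt_zero]
    exact Real.rpow_pos_of_pos (neg_pos.mpr hlt') _

/-- Theorem 2.2. Under the noncanonical condition `θ(ζ₀) < ∞`, if
`∑_{ζ=ζ₀}^∞ ((1/r ζ) ∑_{s=ζ₀}^{ζ-1} q s · θ^α(s-σ))^{1/α} = ∞` or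
`∑_{s=ζ₀}^∞ q s · θ^{α+1}(s+1) = ∞`, then every solution of (1.1) oscillates. -/
theorem statement1
    (m n : ℕ) (α : ℝ) (hm : Odd m) (hn : Odd n) (hmn : Nat.Coprime m n)
    (hm0 : 0 < m) (hn0 : 0 < n) (hα : α = (m : ℝ) / n)
    (ζ₀ σ : ℤ) (hσ : 0 ≤ σ)
    (r q : ℤ → ℝ) (hr : ∀ ζ, 0 < r ζ) (hq : ∀ ζ, 0 ≤ q ζ)
    (hq0 : ∀ N : ℤ, ∃ ζ ≥ N, q ζ ≠ 0)
    (hθ : Summable (fun k : ℕ => (r (ζ₀ + k) ^ α⁻¹)⁻¹))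
    (hcond :
      Tendsto
        (fun N : ℤ => ∑ ζ ∈ Finset.Icc ζ₀ N,
          ((r ζ)⁻¹ * ∑ s ∈ Finset.Icc ζ₀ (ζ - 1), q s * theta α r (s - σ) ^ α) ^ α⁻¹)
        atTop atTop
      ∨ Tendsto
          (fun N : ℤ => ∑ s ∈ Finset.Icc ζ₀ N, q s * theta α r (s + 1) ^ (α + 1))
          atTop atTop)
    (x : ℤ → ℝ) (hnt : ∃ ζ, x ζ ≠ 0)
    (hsol : ∀ ζ ≥ ζ₀, fwd (fun t => r t * ratPow m n (fwd x t)) ζ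
        + q ζ * ratPow m n (x (ζ - σ)) = 0) :
    Oscillates x := by
  have hn' := hn0.ne'
  refine ⟨not_evPos_of_divergenceCondition hm hn' hα hσ hr hq hθ hcond hsol, ?_⟩
  rintro ⟨N, hN⟩
  refine not_evPos_of_divergenceCondition (x := fun t => -x t) hm hn' hα hσ hr hq hθ hcond
    (fun ζ hζ => ?_) ⟨N, fun ζ hζ => neg_pos.mpr (hN ζ hζ)⟩
  simp only [fwd_neg, ratPow_neg hm hn', mul_neg]
  linarith [hsol ζ hζ]
end

section
/- Suppose θ(ζ₀) < ∞ and ∑_{ζ=ζ₀}^∞ q(ζ) = ∞. If {x(ζ)} is an eventually positive solution of equation (1.1), then Δx(ζ) < 0 eventually. -/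
open Filter Finset

lemma oddRoot_neg_of_neg (n : ℕ) {t : ℝ} (ht : t < 0) : oddRoot n t < 0 := by
  rw [oddRoot, if_pos ht, neg_lt_zero]
  exact Real.rpow_pos_of_pos (neg_pos.2 ht) _

lemma oddRoot_pos (n : ℕ) {t : ℝ} (ht : 0 < t) : 0 < oddRoot n t := by
  rw [oddRoot, if_neg ht.not_gt]
  exact Real.rpow_pos_of_pos ht _

lemma oddRoot_nonneg (n : ℕ) {t : ℝ} (ht : 0 ≤ t) : 0 ≤ oddRoot n t := by
  rw [oddRoot, if_neg ht.not_gt]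
  exact Real.rpow_nonneg ht _

lemma oddRoot_le_oddRoot (n : ℕ) {s t : ℝ} (hs : 0 ≤ s) (hst : s ≤ t) :
    oddRoot n s ≤ oddRoot n t := by
  rw [oddRoot, oddRoot, if_neg hs.not_gt, if_neg (hs.trans hst).not_gt]
  exact Real.rpow_le_rpow hs hst (by positivity)

lemma ratPow_neg_of_neg {m : ℕ} (hm : Odd m) (n : ℕ) {t : ℝ} (ht : t < 0) :
    ratPow m n t < 0 := by
  rw [ratPow, zpow_natCast]
  exact hm.pow_neg (oddRoot_neg_of_neg n ht)

lemma ratPow_pos (p : ℤ) (n : ℕ) {t : ℝ} (ht : 0 < t) : 0 < ratPow p n t :=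
  zpow_pos (oddRoot_pos n ht) p

lemma ratPow_nonneg (p : ℤ) (n : ℕ) {t : ℝ} (ht : 0 ≤ t) : 0 ≤ ratPow p n t :=
  zpow_nonneg (oddRoot_nonneg n ht) p

lemma ratPow_le_ratPow (m n : ℕ) {s t : ℝ} (hs : 0 ≤ s) (hst : s ≤ t) :
    ratPow m n s ≤ ratPow m n t := by
  rw [ratPow, ratPow, zpow_natCast, zpow_natCast]
  exact pow_le_pow_left₀ (oddRoot_nonneg n hs) (oddRoot_le_oddRoot n hs hst) m

lemma le_of_fwd_nonneg {x : ℤ → ℝ} {M : ℤ} (h : ∀ ζ ≥ M, 0 ≤ fwd x ζ) {ζ : ℤ} (hζ : M ≤ ζ) :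
    x M ≤ x ζ := by
  induction ζ, hζ using Int.leInduction with
  | base => exact le_rfl
  | succ k hk ih => exact ih.trans (sub_nonneg.1 (h k hk))

lemma le_of_fwd_nonpos {x : ℤ → ℝ} {M : ℤ} (h : ∀ ζ ≥ M, fwd x ζ ≤ 0) {ζ : ℤ} (hζ : M ≤ ζ) :
    x ζ ≤ x M := by
  induction ζ, hζ using Int.leInduction with
  | base => exact le_rfl
  | succ k hk ih => exact (sub_nonpos.1 (h k hk)).trans ih

/-- If `Δw ≤ -c q` eventually with `c > 0` and `∑ q = ∞`, then `w` takes negative values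
arbitrarily late. -/
lemma exists_neg_of_fwd_add_mul_nonpos {w q : ℤ → ℝ} {ζ₀ M : ℤ} {c : ℝ} (hc : 0 < c)
    (hM : ζ₀ ≤ M) (hw : ∀ ζ ≥ M, fwd w ζ + c * q ζ ≤ 0)
    (hq : Tendsto (fun N : ℤ => ∑ ζ ∈ Finset.Icc ζ₀ N, q ζ) atTop atTop) :
    ∃ ζ ≥ M, w ζ < 0 := by
  let S : ℤ → ℝ := fun N => ∑ ζ ∈ Finset.Icc ζ₀ N, q ζ
  have key : ∀ N ≥ M, w (N + 1) + c * S N ≤ w (M + 1) + c * S M := by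
    intro N hN
    refine le_of_fwd_nonpos (x := fun N => w (N + 1) + c * S N) (fun k hk => ?_) hN
    have hS : S (k + 1) = q (k + 1) + S k := by
      have hI : Finset.Icc ζ₀ (k + 1) = insert (k + 1) (Finset.Icc ζ₀ k) := by
        ext a
        simp only [Finset.mem_Icc, Finset.mem_insert]
        omega
      simp only [S]
      rw [hI, Finset.sum_insert (by simp)]
    have h := hw (k + 1) (by omega)
    simp only [fwd] at h ⊢
    rw [hS]
    linarith
  obtain ⟨N, hNM, hN⟩ :=
    ((eventually_ge_atTop M).and
      (hq.eventually_gt_atTop ((w (M + 1) + c * S M) / c))).exists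
  refine ⟨N + 1, by omega, ?_⟩
  have h := key N hNM
  rw [div_lt_iff₀' hc] at hN
  linarith

/-- Lemma 2.1. Under the noncanonical condition `θ(ζ₀) < ∞`, if
`∑_{ζ=ζ₀}^∞ q ζ = ∞` and `x` is an eventually positive solution of (1.1), then
`Δx(ζ) < 0` eventually. -/
theorem statement3
    (m n : ℕ) (α : ℝ) (hm : Odd m) (hn : Odd n) (hmn : Nat.Coprime m n)
    (hm0 : 0 < m) (hn0 : 0 < n) (hα : α = (m : ℝ) / n)
    (ζ₀ σ : ℤ) (hσ : 0 ≤ σ)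
    (r q : ℤ → ℝ) (hr : ∀ ζ, 0 < r ζ) (hq : ∀ ζ, 0 ≤ q ζ)
    (hq0 : ∀ N : ℤ, ∃ ζ ≥ N, q ζ ≠ 0)
    (hθ : Summable (fun k : ℕ => (r (ζ₀ + k) ^ α⁻¹)⁻¹))
    (hqdiv : Tendsto (fun N : ℤ => ∑ ζ ∈ Finset.Icc ζ₀ N, q ζ) atTop atTop)
    (x : ℤ → ℝ)
    (hsol : ∀ ζ ≥ ζ₀, fwd (fun t => r t * ratPow m n (fwd x t)) ζ
        + q ζ * ratPow m n (x (ζ - σ)) = 0)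
    (hpos : EvPos x) :
    ∃ N : ℤ, ∀ ζ ≥ N, fwd x ζ < 0 := by
  obtain ⟨N, hN⟩ := hpos
  set w : ℤ → ℝ := fun t => r t * ratPow m n (fwd x t)
  have fwd_neg : ∀ ζ, w ζ < 0 → fwd x ζ < 0 := by
    intro ζ h
    by_contra! h0
    exact h.not_ge (mul_nonneg (hr ζ).le (ratPow_nonneg m n h0))
  obtain ⟨M, hMζ, hMN⟩ : ∃ M, ζ₀ ≤ M ∧ N + σ ≤ M := ⟨_, le_max_left _ _, le_max_right _ _⟩
  have fwd_w_nonpos : ∀ ζ ≥ M, fwd w ζ ≤ 0 := by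
    intro ζ hζ
    have h := hsol ζ (by omega)
    have := mul_nonneg (hq ζ) (ratPow_pos m n (hN (ζ - σ) (by omega))).le
    linarith
  obtain ⟨K, hK, hwK⟩ : ∃ K ≥ M, w K < 0 := by
    by_contra! hnn
    have hx : ∀ ζ ≥ M, 0 ≤ fwd x ζ := by
      intro ζ hζ
      by_contra! h
      exact (hnn ζ hζ).not_gt (mul_neg_of_pos_of_neg (hr ζ) (ratPow_neg_of_neg hm n h))
    have hxM : 0 < x M := hN M (by omega)
    obtain ⟨ζ, hζ, hwζ⟩ := exists_neg_of_fwd_add_mul_nonpos (w := w) (M := M + σ)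
      (ratPow_pos m n hxM) (by omega) (fun ζ hζ => by
        have h := hsol ζ (by omega)
        have := mul_le_mul_of_nonneg_left
          (ratPow_le_ratPow m n hxM.le (le_of_fwd_nonneg hx (ζ := ζ - σ) (by omega))) (hq ζ)
        linarith) hqdiv
    exact (hnn ζ (by omega)).not_gt hwζ
  exact ⟨K, fun ζ hζ => fwd_neg ζ
    ((le_of_fwd_nonpos (fun k hk => fwd_w_nonpos k (hK.trans hk)) hζ).trans_lt hwK)⟩
end

section
/- Let {r̃(ζ)} be a sequence of positive reals with ∑_{ζ=ζ₀}^∞ 1/r̃(ζ) = ∞, let q̃(ζ) ≥ 0, and let σ ≥ 1 be an integer. If the second-order linear delay difference inequality Δ(r̃(ζ)·Δx(ζ−1)) + q̃(ζ)·x(ζ−σ) ≤ 0 has an eventually positive solution, then the equation Δ(r̃(ζ)·Δx(ζ−1)) + q̃(ζ)·x(ζ−σ) = 0 has an eventually positive solution. -/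
open Filter Finset

/-- If the quasi-differences `r ζ * (x ζ - x (ζ - 1))` of a positive sequence are nonincreasing and
`∑ 1 / r` diverges, then they are nonnegative. -/
theorem quasiDiff_nonneg {ζ₀ M : ℤ} (hM : ζ₀ ≤ M) {r x : ℤ → ℝ} (hr : ∀ ζ, 0 < r ζ)
    (hdiv : Tendsto (fun N : ℤ => ∑ ζ ∈ Finset.Icc ζ₀ N, (r ζ)⁻¹) atTop atTop)
    (hx : ∀ ζ ≥ M, 0 < x ζ)
    (hanti : ∀ ζ ≥ M, r (ζ + 1) * (x (ζ + 1) - x ζ) ≤ r ζ * (x ζ - x (ζ - 1)))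
    {s : ℤ} (hs : M ≤ s) : 0 ≤ r s * (x s - x (s - 1)) := by
  by_contra! hneg
  set c := r s * (x s - x (s - 1)) with hc
  set S : ℤ → ℝ := fun N => ∑ ζ ∈ Finset.Icc ζ₀ N, (r ζ)⁻¹ with hS
  have hstep : ∀ ζ ≥ M, S (ζ + 1) = S ζ + (r (ζ + 1))⁻¹ := by
    intro ζ hζ
    have : Finset.Icc ζ₀ (ζ + 1) = insert (ζ + 1) (Finset.Icc ζ₀ ζ) := by
      ext a; simp only [Finset.mem_Icc, Finset.mem_insert]; omega
    simp only [hS]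
    rw [this, Finset.sum_insert (by simp), add_comm]
  have key : ∀ ζ, s ≤ ζ → r ζ * (x ζ - x (ζ - 1)) ≤ c ∧ x ζ ≤ x s + c * (S ζ - S s) := by
    intro ζ hζ
    induction ζ, hζ using Int.leInduction with
    | base => simp [hc]
    | succ ζ hζ ih =>
      have h1 : r (ζ + 1) * (x (ζ + 1) - x ζ) ≤ c := (hanti ζ (hs.trans hζ)).trans ih.1
      have h2 : x (ζ + 1) - x ζ ≤ c * (r (ζ + 1))⁻¹ := by
        rw [← div_eq_mul_inv, le_div_iff₀ (hr _)]; linarith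
      rw [hstep ζ (hs.trans hζ), add_sub_cancel_right]
      exact ⟨h1, by linarith [ih.2]⟩
  obtain ⟨ζ, hζ, hζs⟩ :=
    ((hdiv.eventually_ge_atTop (S s + x s / -c)).and (eventually_ge_atTop s)).exists
  have h1 := (key ζ hζs).2
  have h2 : x s / -c ≤ S ζ - S s := by simp only [hS] at hζ ⊢; linarith
  rw [div_le_iff₀ (by linarith)] at h2
  linarith [hx ζ (hs.trans hζs)]

/-- The tail `∑_{t ≥ s} q t * y (t - σ)`, as an extended nonnegative real. -/
noncomputable def delayTail (σ : ℤ) (q : ℤ → ℝ) (y : ℤ → ENNReal) (s : ℤ) : ENNReal :=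
  ∑' k : ℕ, ENNReal.ofReal (q (s + k)) * y (s + k - σ)

theorem delayTail_eq (σ : ℤ) (q : ℤ → ℝ) (y : ℤ → ENNReal) (s : ℤ) :
    delayTail σ q y s = ENNReal.ofReal (q s) * y (s - σ) + delayTail σ q y (s + 1) := by
  unfold delayTail
  rw [tsum_eq_zero_add' ENNReal.summable]
  simp only [Nat.cast_zero, add_zero, Nat.cast_add, Nat.cast_one]
  simp only [add_assoc, add_comm (1 : ℤ)]

theorem delayTail_mono (σ : ℤ) (q : ℤ → ℝ) (s : ℤ) : Monotone fun y => delayTail σ q y s :=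
  fun _ _ h => ENNReal.tsum_le_tsum fun _ => mul_le_mul_right (h _) _

/-- If `d` is nonnegative and drops by at least `q ζ * x (ζ - σ)` at each step `ζ ≥ M`, then it
dominates the tails of `q ζ * x (ζ - σ)`. -/
theorem delayTail_le {M σ : ℤ} {q x d : ℤ → ℝ} (hq : ∀ ζ, 0 ≤ q ζ) (hd : ∀ ζ ≥ M, 0 ≤ d ζ)
    (hx : ∀ ζ ≥ M, 0 < x (ζ - σ))
    (h : ∀ ζ ≥ M, q ζ * x (ζ - σ) + d (ζ + 1) ≤ d ζ) {s : ℤ} (hs : M ≤ s) :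
    delayTail σ q (fun ζ => ENNReal.ofReal (x ζ)) s ≤ ENNReal.ofReal (d s) := by
  refine ENNReal.tsum_le_of_sum_range_le fun n => ?_
  suffices H : (∑ k ∈ range n, ENNReal.ofReal (q (s + k)) * ENNReal.ofReal (x (s + k - σ)))
      + ENNReal.ofReal (d (s + n)) ≤ ENNReal.ofReal (d s) from le_self_add.trans H
  induction n with
  | zero => simp
  | succ n ih =>
    have hn : M ≤ s + n := by omega
    rw [sum_range_succ, add_assoc]
    refine le_trans (add_le_add_right ?_ _) ih
    push_cast
    rw [← add_assoc, ← ENNReal.ofReal_mul (hq _),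
      ← ENNReal.ofReal_add (mul_nonneg (hq _) (hx _ hn).le) (hd _ (by omega))]
    exact ENNReal.ofReal_le_ofReal (h _ hn)

/-- The monotone summation operator whose fixed points solve the delay difference equation beyond
`M`, with initial data `x` up to `M`. -/
noncomputable def delaySum (M σ : ℤ) (r q x : ℤ → ℝ) :
    (ℤ → ENNReal) →o (ℤ → ENNReal) where
  toFun y ζ := ENNReal.ofReal (x (min ζ M)) + ∑ i ∈ range (ζ - M).toNat,
    ENNReal.ofReal (r (M + i + 1))⁻¹ * delayTail σ q y (M + i + 1)
  monotone' _ _ h _ := add_le_add_right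
    (Finset.sum_le_sum fun _ _ => mul_le_mul_right (delayTail_mono σ q _ h) _) _

theorem delaySum_apply (M σ : ℤ) (r q x : ℤ → ℝ) (y : ℤ → ENNReal) (ζ : ℤ) :
    delaySum M σ r q x y ζ = ENNReal.ofReal (x (min ζ M)) + ∑ i ∈ range (ζ - M).toNat,
      ENNReal.ofReal (r (M + i + 1))⁻¹ * delayTail σ q y (M + i + 1) := rfl

theorem delaySum_of_le {M σ : ℤ} (r q x : ℤ → ℝ) (y : ℤ → ENNReal) {ζ : ℤ} (h : ζ ≤ M) :
    delaySum M σ r q x y ζ = ENNReal.ofReal (x ζ) := by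
  simp [delaySum_apply, Int.toNat_of_nonpos (sub_nonpos.2 h), h]

theorem delaySum_succ {M σ : ℤ} (r q x : ℤ → ℝ) (y : ℤ → ENNReal) {ζ : ℤ} (h : M ≤ ζ) :
    delaySum M σ r q x y (ζ + 1) = delaySum M σ r q x y ζ +
      ENNReal.ofReal (r (ζ + 1))⁻¹ * delayTail σ q y (ζ + 1) := by
  have h1 : (ζ + 1 - M).toNat = (ζ - M).toNat + 1 := by omega
  have h2 : M + ((ζ - M).toNat : ℤ) = ζ := by omega
  rw [delaySum_apply, delaySum_apply, h1, sum_range_succ, h2, min_eq_right h, min_eq_right (by omega), add_assoc]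

/-- Lemma 2.3. If the canonical second-order linear delay difference
inequality `Δ(r̃(ζ)·Δx(ζ-1)) + q̃(ζ)·x(ζ-σ) ≤ 0` has an eventually positive solution,
then the corresponding equation (2.21) has an eventually positive solution. -/
theorem statement4
    (ζ₀ σ : ℤ) (hσ : 1 ≤ σ)
    (rt qt : ℤ → ℝ) (hrt : ∀ ζ, 0 < rt ζ) (hqt : ∀ ζ, 0 ≤ qt ζ)
    (hcan : Tendsto (fun N : ℤ => ∑ ζ ∈ Finset.Icc ζ₀ N, (rt ζ)⁻¹) atTop atTop)
    (hineq : ∃ x : ℤ → ℝ, ∃ N ≥ ζ₀, ∀ ζ ≥ N, 0 < x ζ ∧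
      rt (ζ + 1) * (x (ζ + 1) - x ζ) - rt ζ * (x ζ - x (ζ - 1))
        + qt ζ * x (ζ - σ) ≤ 0) :
    ∃ y : ℤ → ℝ, ∃ N ≥ ζ₀, ∀ ζ ≥ N, 0 < y ζ ∧
      rt (ζ + 1) * (y (ζ + 1) - y ζ) - rt ζ * (y ζ - y (ζ - 1))
        + qt ζ * y (ζ - σ) = 0 := by
  obtain ⟨x, N, hN, hx⟩ := hineq
  set M := N + σ with hM
  set d : ℤ → ℝ := fun ζ => rt ζ * (x ζ - x (ζ - 1)) with hd_def
  have hpos : ∀ ζ ≥ N, 0 < x ζ := fun ζ hζ => (hx ζ hζ).1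
  have hdel : ∀ ζ ≥ M, 0 < x (ζ - σ) := fun ζ hζ => hpos _ (by omega)
  have hdrop : ∀ ζ ≥ M, qt ζ * x (ζ - σ) + d (ζ + 1) ≤ d ζ := by
    intro ζ hζ
    have := (hx ζ (by omega)).2
    simp only [hd_def, add_sub_cancel_right]
    linarith
  have hd : ∀ ζ ≥ M, 0 ≤ d ζ := fun ζ hζ =>
    quasiDiff_nonneg (by omega : ζ₀ ≤ M) hrt hcan (fun ζ hζ => hpos ζ (by omega))
      (fun ζ hζ => by
        have h1 := hdrop ζ hζ
        have h2 := mul_nonneg (hqt ζ) (hdel ζ hζ).le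
        simp only [hd_def, add_sub_cancel_right] at h1
        linarith) hζ
  set T := delaySum M σ rt qt x with hT
  have hTx : T (fun ζ => ENNReal.ofReal (x ζ)) ≤ fun ζ => ENNReal.ofReal (x ζ) := by
    intro ζ
    rcases le_total ζ M with h | h
    · exact (delaySum_of_le _ _ _ _ h).le
    · induction ζ, h using Int.leInduction with
      | base => exact (delaySum_of_le _ _ _ _ le_rfl).le
      | succ ζ h ih =>
        rw [hT, delaySum_succ _ _ _ _ h]
        refine (add_le_add ih (mul_le_mul_right
          (delayTail_le hqt hd hdel hdrop (by omega)) _)).trans ?_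
        have hr := hrt (ζ + 1)
        rw [← ENNReal.ofReal_mul (by positivity), ← ENNReal.ofReal_add
          (hpos _ (by omega)).le (mul_nonneg (by positivity) (hd _ (by omega)))]
        refine ENNReal.ofReal_le_ofReal (le_of_eq ?_)
        simp only [hd_def, add_sub_cancel_right]
        field_simp
        ring
  set y := T.lfp with hy_def
  have hy : T y = y := T.map_lfp
  have hyx : ∀ ζ, y ζ ≤ ENNReal.ofReal (x ζ) := T.lfp_le hTx
  have hfin : ∀ ζ, y ζ ≠ ⊤ := fun ζ => ((hyx ζ).trans_lt ENNReal.ofReal_lt_top).ne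
  have hsucc : ∀ ζ ≥ M, y (ζ + 1) =
      y ζ + ENNReal.ofReal (rt (ζ + 1))⁻¹ * delayTail σ qt y (ζ + 1) := by
    intro ζ hζ
    have := delaySum_succ (σ := σ) rt qt x y hζ
    rwa [← hT, hy] at this
  have htail : ∀ ζ ≥ M, delayTail σ qt y (ζ + 1) ≠ ⊤ := by
    intro ζ hζ htop
    refine hfin (ζ + 1) ?_
    rw [hsucc ζ hζ, htop, ENNReal.mul_top (by simpa using hrt (ζ + 1)), add_top]
  have hdiff : ∀ ζ ≥ M, rt (ζ + 1) * ((y (ζ + 1)).toReal - (y ζ).toReal) =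
      (delayTail σ qt y (ζ + 1)).toReal := by
    intro ζ hζ
    have hr := hrt (ζ + 1)
    rw [hsucc ζ hζ, ENNReal.toReal_add (hfin ζ)
      (ENNReal.mul_ne_top ENNReal.ofReal_ne_top (htail ζ hζ)), ENNReal.toReal_mul,
      ENNReal.toReal_ofReal (by positivity)]
    field_simp
    ring
  refine ⟨fun ζ => (y ζ).toReal, M + 1, by omega, fun ζ hζ => ⟨?_, ?_⟩⟩
  · refine ENNReal.toReal_pos (ne_of_gt ?_) (hfin ζ)
    rw [← hy]
    refine lt_of_lt_of_le ?_ le_self_add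
    exact ENNReal.ofReal_pos.2 (hpos _ (by omega))
  · obtain ⟨η, rfl⟩ : ∃ η, ζ = η + 1 := ⟨ζ - 1, by ring⟩
    have hη : M ≤ η := by omega
    have h := congrArg ENNReal.toReal (delayTail_eq σ qt y (η + 1))
    rw [ENNReal.toReal_add (ENNReal.mul_ne_top ENNReal.ofReal_ne_top (hfin _))
      (htail _ (by omega)), ENNReal.toReal_mul, ENNReal.toReal_ofReal (hqt _)] at h
    rw [add_sub_cancel_right, hdiff (η + 1) (by omega), hdiff η hη]
    linarith
end

section
/- Suppose α ≥ 1 and θ(ζ₀) < ∞. If {x(ζ)} is an eventually positive solution of equation (1.1'), then for all sufficiently large ζ one has ( r^{1/α}(ζ)·Δx(ζ) / x(ζ−σ+1) )^{α−1} ≤ θ^{1−α}(ζ). -/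
open Filter Finset

theorem abs_oddRoot (n : ℕ) (t : ℝ) : |oddRoot n t| = |t| ^ ((n : ℝ))⁻¹ := by
  unfold oddRoot
  split_ifs with h
  · rw [abs_neg, abs_of_neg h, abs_of_nonneg (Real.rpow_nonneg (by linarith) _)]
  · rw [abs_of_nonneg (not_lt.mp h), abs_of_nonneg (Real.rpow_nonneg (not_lt.mp h) _)]

theorem oddRoot_pow {n : ℕ} (hn : Odd n) (t : ℝ) : oddRoot n t ^ n = t := by
  have hn0 : n ≠ 0 := hn.pos.ne'
  unfold oddRoot
  split_ifs with h
  · rw [hn.neg_pow, Real.rpow_inv_natCast_pow (by linarith) hn0, neg_neg]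
  · exact Real.rpow_inv_natCast_pow (not_lt.mp h) hn0

/-- For odd `m` and `n`, comparing `r * t ^ (m / n)` amounts to comparing `r ^ (n / m) * t`. -/
theorem rpow_mul_le_of_mul_ratPow_le {m n : ℕ} (hm : Odd m) (hn : Odd n) {r₁ r₂ t₁ t₂ : ℝ}
    (hr₁ : 0 < r₁) (hr₂ : 0 < r₂) (h : r₁ * ratPow m n t₁ ≤ r₂ * ratPow m n t₂) :
    r₁ ^ ((m : ℝ) / n)⁻¹ * t₁ ≤ r₂ ^ ((m : ℝ) / n)⁻¹ * t₂ := by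
  have hm0 : m ≠ 0 := hm.pos.ne'
  have low {r : ℝ} (hr : 0 < r) (t : ℝ) :
      r * ratPow m n t = (r ^ ((m : ℝ))⁻¹ * oddRoot n t) ^ m := by
    rw [mul_pow, Real.rpow_inv_natCast_pow hr.le hm0, ratPow, zpow_natCast]
  have high {r : ℝ} (hr : 0 < r) (t : ℝ) :
      r ^ ((m : ℝ) / n)⁻¹ * t = (r ^ ((m : ℝ))⁻¹ * oddRoot n t) ^ n := by
    rw [mul_pow, oddRoot_pow hn, ← Real.rpow_natCast, ← Real.rpow_mul hr.le, inv_div,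
      div_eq_inv_mul]
  rw [low hr₁, low hr₂, hm.strictMono_pow.le_iff_le] at h
  rw [high hr₁, high hr₂]
  exact hn.strictMono_pow.monotone h

theorem ratPow_sub_eq_abs_rpow {m n : ℕ} (hm : Odd m) (hn : Odd n) (t : ℝ) :
    ratPow ((m : ℤ) - n) n t = |t| ^ ((m : ℝ) / n - 1) := by
  have hn0 : (n : ℝ) ≠ 0 := Nat.cast_ne_zero.mpr hn.pos.ne'
  have he : Even ((m : ℤ) - n) := (hm.natCast (R := ℤ)).sub_odd hn.natCast
  rw [ratPow, ← he.zpow_abs, abs_oddRoot, ← Real.rpow_intCast,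
    ← Real.rpow_mul (abs_nonneg t)]
  congr 1
  push_cast
  field_simp

theorem sum_range_fwd (x : ℤ → ℝ) (ζ : ℤ) (K : ℕ) :
    ∑ k ∈ range K, fwd x (ζ + k) = x (ζ + K) - x ζ := by
  have := Finset.sum_range_sub (fun k : ℕ => x (ζ + k)) K
  simpa [fwd, add_assoc] using this

theorem le_of_fwd_nonneg_s5 {x : ℤ → ℝ} {M : ℤ} (h : ∀ s ≥ M, 0 ≤ fwd x s) {a b : ℤ}
    (ha : M ≤ a) (hab : a ≤ b) : x a ≤ x b := by
  induction b, hab using Int.leInduction with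
  | base => exact le_rfl
  | succ b hb ih =>
    have := h b (by lia)
    unfold fwd at this
    linarith

theorem le_of_fwd_nonpos_s5 {x : ℤ → ℝ} {M : ℤ} (h : ∀ s ≥ M, fwd x s ≤ 0) {a b : ℤ}
    (ha : M ≤ a) (hab : a ≤ b) : x b ≤ x a := by
  induction b, hab using Int.leInduction with
  | base => exact le_rfl
  | succ b hb ih =>
    have := h b (by lia)
    unfold fwd at this
    linarith

theorem summable_int_shift {a : ℤ → ℝ} {ζ₀ ζ : ℤ} (hζ : ζ₀ ≤ ζ)
    (h : Summable fun k : ℕ => a (ζ₀ + k)) : Summable fun k : ℕ => a (ζ + k) := by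
  obtain ⟨i, rfl⟩ := Int.le.dest hζ
  refine ((summable_nat_add_iff i).mpr h).congr fun k => ?_
  congr 1
  push_cast
  ring

theorem eventually_tsum_int_shift_lt {a : ℤ → ℝ} {ζ₀ : ℤ} {ε : ℝ} (hε : 0 < ε) :
    ∃ N : ℤ, ∀ ζ ≥ N, ∑' k : ℕ, a (ζ + k) < ε := by
  obtain ⟨i₀, hi₀⟩ := eventually_atTop.mp
    ((tendsto_sum_nat_add fun k : ℕ => a (ζ₀ + k)).eventually_lt_const hε)
  refine ⟨ζ₀ + i₀, fun ζ hζ => ?_⟩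
  obtain ⟨j, rfl⟩ := Int.le.dest hζ
  refine lt_of_eq_of_lt (tsum_congr fun k => ?_) (hi₀ (i₀ + j) (by lia))
  congr 1
  push_cast
  ring

/-- If `Δx = R a` with `a` positive, `R` nonincreasing and `x` positive, then
`|R| ∑ a` is eventually dominated by a delayed value of `x`. -/
theorem eventually_abs_mul_tsum_le {a R x : ℤ → ℝ} {M σ : ℤ} (hσ : 1 ≤ σ)
    (ha : ∀ s, 0 < a s) (hx : ∀ s ≥ M, 0 < x s) (hfwd : ∀ s, fwd x s = R s * a s)
    (hR : ∀ s ≥ M, fwd R s ≤ 0) :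
    ∃ N : ℤ, ∀ ζ ≥ N, |R ζ| * ∑' k : ℕ, a (ζ + k) ≤ x (ζ - σ + 1) := by
  by_cases hneg : ∃ P ≥ M, R P < 0
  · obtain ⟨P, hPM, hP⟩ := hneg
    have hRneg : ∀ s ≥ P, R s < 0 := fun s hs => (le_of_fwd_nonpos_s5 hR hPM hs).trans_lt hP
    have hdec : ∀ s ≥ P, fwd x s ≤ 0 := fun s hs => by
      rw [hfwd]
      exact mul_nonpos_of_nonpos_of_nonneg (hRneg s hs).le (ha s).le
    refine ⟨P + σ, fun ζ hζ => ?_⟩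
    refine le_trans ?_ (le_of_fwd_nonpos_s5 hdec (a := ζ - σ + 1) (b := ζ) (by lia) (by lia))
    rw [← tsum_mul_left]
    refine Real.tsum_le_of_sum_range_le (fun k => mul_nonneg (abs_nonneg _) (ha _).le) fun K => ?_
    have hle : ∑ k ∈ range K, |R ζ| * a (ζ + k) ≤ -∑ k ∈ range K, fwd x (ζ + k) := by
      rw [← Finset.sum_neg_distrib]
      refine Finset.sum_le_sum fun k _ => ?_
      have hmono := le_of_fwd_nonpos_s5 hR (a := ζ) (b := ζ + k) (by lia) (by lia)
      rw [abs_of_neg (hRneg ζ (by lia)), hfwd, ← neg_mul]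
      exact mul_le_mul_of_nonneg_right (neg_le_neg hmono) (ha _).le
    rw [sum_range_fwd] at hle
    linarith [hx (ζ + K) (by lia)]
  · push Not at hneg
    have hinc : ∀ s ≥ M, 0 ≤ fwd x s := fun s hs => by
      rw [hfwd]
      exact mul_nonneg (hneg s hs) (ha s).le
    have hden : 0 < R M + 1 := by linarith [hneg M le_rfl]
    obtain ⟨N, hN⟩ := eventually_tsum_int_shift_lt (a := a) (ζ₀ := M)
      (div_pos (hx M le_rfl) hden)
    refine ⟨max N (M + σ), fun ζ hζ => ?_⟩
    have hζN : N ≤ ζ := le_trans (le_max_left _ _) hζ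
    have hζM : M + σ ≤ ζ := le_trans (le_max_right _ _) hζ
    have hRζ : R ζ ≤ R M := le_of_fwd_nonpos_s5 hR le_rfl (by lia)
    have htail := (lt_div_iff₀ hden).mp (hN ζ hζN)
    have hnn : 0 ≤ ∑' k : ℕ, a (ζ + k) := tsum_nonneg fun k => (ha _).le
    have hxM := le_of_fwd_nonneg_s5 hinc (a := M) (b := ζ - σ + 1) le_rfl (by lia)
    rw [abs_of_nonneg (hneg ζ (by lia))]
    nlinarith [mul_le_mul_of_nonneg_right hRζ hnn]

/-- Lemma 2.2. Suppose `α ≥ 1` and `θ(ζ₀) < ∞`. If `x` is an eventually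
positive solution of (1.1'), then eventually
`(r^{1/α}(ζ)·Δx(ζ) / x(ζ-σ+1))^{α-1} ≤ θ^{1-α}(ζ)`. -/
theorem statement5
    (m n : ℕ) (α : ℝ) (hm : Odd m) (hn : Odd n) (hmn : Nat.Coprime m n)
    (hm0 : 0 < m) (hn0 : 0 < n) (hα : α = (m : ℝ) / n) (hα1 : 1 ≤ α)
    (ζ₀ σ : ℤ) (hσ : 1 ≤ σ)
    (r q : ℤ → ℝ) (hr : ∀ ζ, 0 < r ζ) (hq : ∀ ζ, 0 ≤ q ζ)
    (hq0 : ∀ N : ℤ, ∃ ζ ≥ N, q ζ ≠ 0)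
    (hθ : Summable (fun k : ℕ => (r (ζ₀ + k) ^ α⁻¹)⁻¹))
    (x : ℤ → ℝ)
    (hsol : ∀ ζ ≥ ζ₀, fwd (fun t => r t * ratPow m n (fwd x t)) ζ
        + q ζ * ratPow m n (x (ζ - σ + 1)) = 0)
    (hpos : EvPos x) :
    ∃ N : ℤ, ∀ ζ ≥ N,
      ratPow ((m : ℤ) - (n : ℤ)) n (r ζ ^ α⁻¹ * fwd x ζ / x (ζ - σ + 1))
        ≤ theta α r ζ ^ (1 - α) := by
  have ha (s : ℤ) : 0 < (r s ^ α⁻¹)⁻¹ := inv_pos.mpr (Real.rpow_pos_of_pos (hr s) _)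
  obtain ⟨N₀, hN₀⟩ := hpos
  have hx : ∀ s ≥ max ζ₀ N₀, 0 < x s := fun s hs => hN₀ s (le_trans (le_max_right _ _) hs)
  have hdec : ∀ s ≥ max ζ₀ N₀ + σ, fwd (fun s => r s ^ α⁻¹ * fwd x s) s ≤ 0 := by
    intro s hs
    have hζ₀ := le_max_left ζ₀ N₀
    have hxs : 0 ≤ ratPow m n (x (s - σ + 1)) := by
      have := hx (s - σ + 1) (by lia)
      rw [ratPow, oddRoot, if_neg this.not_gt]
      positivity
    have heq := hsol s (by lia)
    have hqx := mul_nonneg (hq s) hxs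
    simp only [fwd] at heq ⊢
    rw [sub_nonpos, hα]
    exact rpow_mul_le_of_mul_ratPow_le hm hn (hr _) (hr _) (by linarith)
  have hfwd (s : ℤ) : fwd x s = r s ^ α⁻¹ * fwd x s * (r s ^ α⁻¹)⁻¹ := by
    have := (Real.rpow_pos_of_pos (hr s) α⁻¹).ne'
    rw [mul_right_comm, mul_inv_cancel₀ this, one_mul]
  obtain ⟨N, hN⟩ := eventually_abs_mul_tsum_le (M := max ζ₀ N₀ + σ) hσ ha
    (fun s hs => hx s (by lia)) hfwd hdec
  refine ⟨max N (max ζ₀ N₀ + σ), fun ζ hζ => ?_⟩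
  have hζN : N ≤ ζ := le_trans (le_max_left _ _) hζ
  have hζM : max ζ₀ N₀ + σ ≤ ζ := le_trans (le_max_right _ _) hζ
  have hxζ := hx (ζ - σ + 1) (by lia)
  have hθpos : 0 < theta α r ζ :=
    (summable_int_shift (a := fun s => (r s ^ α⁻¹)⁻¹) (by lia) hθ).tsum_pos
      (fun k => (ha _).le) 0 (ha _)
  have hbound : |r ζ ^ α⁻¹ * fwd x ζ / x (ζ - σ + 1)| ≤ (theta α r ζ)⁻¹ := by
    rw [abs_div, abs_of_pos hxζ, div_le_iff₀ hxζ, inv_mul_eq_div, le_div_iff₀ hθpos]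
    exact hN ζ hζN
  rw [ratPow_sub_eq_abs_rpow hm hn, ← hα, ← neg_sub α 1, Real.rpow_neg hθpos.le,
    ← Real.inv_rpow hθpos.le]
  exact Real.rpow_le_rpow (abs_nonneg _) hbound (by linarith)
end

section
/- Suppose ∑_{ζ=ζ₀}^∞ ( (1/r(ζ)) ∑_{s=ζ₀}^{ζ−1} q(s) )^{1/α} = ∞. If {x(ζ)} is an eventually positive solution of equation (1.1) with Δx(ζ) < 0 eventually, then lim_{ζ→∞} x(ζ) = 0. -/
open Filter Finset

lemma oddRoot_of_pos {n : ℕ} {t : ℝ} (ht : 0 < t) : oddRoot n t = t ^ ((n : ℝ))⁻¹ :=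
  if_neg ht.not_gt

lemma oddRoot_neg_of_pos {n : ℕ} {t : ℝ} (ht : 0 < t) :
    oddRoot n (-t) = -(t ^ ((n : ℝ))⁻¹) := by
  simp [oddRoot, ht]

lemma ratPow_of_pos {m n : ℕ} {t : ℝ} (ht : 0 < t) :
    ratPow m n t = t ^ ((m : ℝ) / n) := by
  rw [ratPow, oddRoot_of_pos ht, zpow_natCast, ← Real.rpow_natCast, ← Real.rpow_mul ht.le,
    div_eq_inv_mul]

lemma ratPow_neg_of_pos {m n : ℕ} (hm : Odd m) {t : ℝ} (ht : 0 < t) :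
    ratPow m n (-t) = -(t ^ ((m : ℝ) / n)) := by
  rw [ratPow, oddRoot_neg_of_pos ht, zpow_natCast, hm.neg_pow, ← Real.rpow_natCast,
    ← Real.rpow_mul ht.le, div_eq_inv_mul]

lemma Int.sum_Icc_succ_top {M : Type*} [AddCommMonoid M] {a b : ℤ} (hab : a ≤ b + 1)
    (f : ℤ → M) : ∑ k ∈ Icc a (b + 1), f k = ∑ k ∈ Icc a b, f k + f (b + 1) := by
  have h : Icc a (b + 1) = insert (b + 1) (Icc a b) := by
    ext k
    simp only [mem_Icc, mem_insert]
    omega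
  rw [h, sum_insert (by simp), add_comm]

lemma Int.sum_Icc_pred_add {M : Type*} [AddCommMonoid M] {a b : ℤ} (hab : a ≤ b)
    (f : ℤ → M) : ∑ k ∈ Icc a (b - 1), f k + f b = ∑ k ∈ Icc a b, f k := by
  simpa using (Int.sum_Icc_succ_top (a := a) (b := b - 1) (by omega) f).symm

/-- A sequence whose increments dominate a positive multiple of those of the partial sums of `q`
dominates a positive multiple of these partial sums. -/
lemma exists_pos_mul_sum_le {q y : ℤ → ℝ} {a b : ℤ} {c : ℝ} (hab : a ≤ b)
    (hq : ∀ k, 0 ≤ q k) (hc : 0 < c) (hy : 0 < y b)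
    (hinc : ∀ k ≥ b, y k + c * q k ≤ y (k + 1)) :
    ∃ K > 0, ∀ k ≥ b, K * ∑ s ∈ Icc a (k - 1), q s ≤ y k := by
  have hQ : 0 ≤ ∑ s ∈ Icc a (b - 1), q s := sum_nonneg fun s _ => hq s
  refine ⟨min c (y b / (1 + ∑ s ∈ Icc a (b - 1), q s)), by positivity, fun k hk => ?_⟩
  induction k, hk using Int.leInduction with
  | base =>
    calc _ ≤ y b / (1 + ∑ s ∈ Icc a (b - 1), q s) * ∑ s ∈ Icc a (b - 1), q s := by
          gcongr
          exact min_le_right _ _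
      _ ≤ y b := by
          rw [div_mul_eq_mul_div, div_le_iff₀ (by positivity)]
          nlinarith
  | succ k hk ih =>
    rw [add_sub_cancel_right, ← Int.sum_Icc_pred_add (hab.trans hk), mul_add]
    have := mul_le_mul_of_nonneg_right (min_le_left c (y b / (1 + ∑ s ∈ Icc a (b - 1), q s))) (hq k)
    linarith [hinc k hk]

/-- A sequence decreasing at least as fast as a positive multiple of a divergent series of
nonnegative increments cannot stay positive. -/
lemma not_pos_of_add_mul_le {f x : ℤ → ℝ} {a b : ℤ} {K : ℝ} (hab : a ≤ b) (hK : 0 < K)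
    (hf : Tendsto (fun N : ℤ => ∑ k ∈ Icc a N, f k) atTop atTop)
    (hx : ∀ k ≥ b, x (k + 1) + K * f k ≤ x k) : ¬ ∀ k ≥ b, 0 < x k := by
  intro hpos
  have hbound : ∀ k ≥ b, x k + K * ∑ s ∈ Icc a (k - 1), f s
      ≤ x b + K * ∑ s ∈ Icc a (b - 1), f s := by
    intro k hk
    induction k, hk using Int.leInduction with
    | base => rfl
    | succ k hk ih =>
      rw [add_sub_cancel_right, ← Int.sum_Icc_pred_add (hab.trans hk), mul_add]
      linarith [hx k hk]
  obtain ⟨N, hN, hNb⟩ := (((hf.const_mul_atTop hK).eventually_ge_atTop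
    (x b + K * ∑ s ∈ Icc a (b - 1), f s)).and (eventually_ge_atTop b)).exists
  have h := hbound (N + 1) (by omega)
  rw [add_sub_cancel_right] at h
  linarith [hpos (N + 1) (by omega)]

/-- If `∑_{ζ=ζ₀}^∞ ((1/r ζ) ∑_{s=ζ₀}^{ζ-1} q s)^{1/α} = ∞` and `x` is an
eventually positive solution of (1.1) with `Δx(ζ) < 0` eventually, then `x(ζ) → 0`. -/
theorem statement7
    (m n : ℕ) (α : ℝ) (hm : Odd m) (hn : Odd n) (hmn : Nat.Coprime m n)
    (hm0 : 0 < m) (hn0 : 0 < n) (hα : α = (m : ℝ) / n)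
    (ζ₀ σ : ℤ) (hσ : 0 ≤ σ)
    (r q : ℤ → ℝ) (hr : ∀ ζ, 0 < r ζ) (hq : ∀ ζ, 0 ≤ q ζ)
    (hq0 : ∀ N : ℤ, ∃ ζ ≥ N, q ζ ≠ 0)
    (hdiv : Tendsto
      (fun N : ℤ => ∑ ζ ∈ Finset.Icc ζ₀ N,
        ((r ζ)⁻¹ * ∑ s ∈ Finset.Icc ζ₀ (ζ - 1), q s) ^ α⁻¹)
      atTop atTop)
    (x : ℤ → ℝ)
    (hsol : ∀ ζ ≥ ζ₀, fwd (fun t => r t * ratPow m n (fwd x t)) ζ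
        + q ζ * ratPow m n (x (ζ - σ)) = 0)
    (hpos : EvPos x)
    (hdec : ∃ N : ℤ, ∀ ζ ≥ N, fwd x ζ < 0) :
    Tendsto x atTop (nhds 0) := by
  obtain ⟨N₁, hN₁⟩ := hpos
  obtain ⟨N₂, hN₂⟩ := hdec
  have hα0 : 0 < α := by rw [hα]; positivity
  have hanti : ∀ a ≥ N₂, ∀ b ≥ a, x b ≤ x a := by
    intro a ha b hb
    induction b, hb using Int.leInduction with
    | base => rfl
    | succ b hb ih =>
      have := hN₂ b (by omega)
      rw [fwd] at this
      linarith
  have hsmall : ∀ ε > 0, ∃ k ≥ max N₁ N₂, x k < ε := by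
    intro ε hε
    by_contra! hge
    obtain ⟨b, hb₀, hb₁⟩ : ∃ b, ζ₀ ≤ b ∧ max N₁ N₂ + σ ≤ b :=
      ⟨_, le_max_left _ _, le_max_right _ _⟩
    have hbN₁ : N₁ ≤ b := by omega
    have hbN₂ : N₂ ≤ b := by omega
    have hd : ∀ k ≥ b, 0 < -fwd x k := fun k hk => neg_pos.2 (hN₂ k (hbN₂.trans hk))
    have hinc : ∀ k ≥ b, r k * (-fwd x k) ^ α + ε ^ α * q k
        ≤ r (k + 1) * (-fwd x (k + 1)) ^ α := by
      intro k hk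
      have hflux : ∀ j ≥ b, ratPow m n (fwd x j) = -((-fwd x j) ^ α) := fun j hj => by
        rw [hα, ← ratPow_neg_of_pos hm (hd j hj), neg_neg]
      have hs := hsol k (hb₀.trans hk)
      have hxk : ε ≤ x (k - σ) := hge _ (by omega)
      rw [fwd, hflux k hk, hflux (k + 1) (by omega), ratPow_of_pos (hε.trans_le hxk), ← hα] at hs
      have := mul_le_mul_of_nonneg_left (Real.rpow_le_rpow hε.le hxk hα0.le) (hq k)
      linarith
    obtain ⟨K, hK, hKle⟩ := exists_pos_mul_sum_le (y := fun k => r k * (-fwd x k) ^ α) hb₀ hq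
      (Real.rpow_pos_of_pos hε α) (mul_pos (hr b) (Real.rpow_pos_of_pos (hd b le_rfl) α)) hinc
    refine not_pos_of_add_mul_le hb₀ (Real.rpow_pos_of_pos hK α⁻¹) hdiv (fun k hk => ?_)
      fun k hk => hN₁ k (hbN₁.trans hk)
    have hQ : 0 ≤ (r k)⁻¹ * ∑ s ∈ Icc ζ₀ (k - 1), q s :=
      mul_nonneg (inv_nonneg.2 (hr k).le) (sum_nonneg fun s _ => hq s)
    have hle : (K * ((r k)⁻¹ * ∑ s ∈ Icc ζ₀ (k - 1), q s)) ^ α⁻¹ ≤ -fwd x k := by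
      rw [Real.rpow_inv_le_iff_of_pos (mul_nonneg hK.le hQ) (hd k hk).le hα0, mul_left_comm,
        inv_mul_le_iff₀ (hr k)]
      exact hKle k hk
    rw [Real.mul_rpow hK.le hQ, fwd] at hle
    linarith
  rw [Metric.tendsto_atTop]
  intro ε hε
  obtain ⟨N, hN, hNε⟩ := hsmall ε hε
  refine ⟨N, fun k hk => ?_⟩
  rw [Real.dist_0_eq_abs, abs_of_pos (hN₁ k (by omega))]
  exact (hanti N (by omega) k hk).trans_lt hNε
end

section
/- Suppose θ(ζ₀) < ∞. If {x(ζ)} is an eventually positive solution of equation (1.1') with Δx(ζ) > 0 eventually, then for all sufficiently large ζ one has x(ζ−σ+1) ≥ θ(ζ)·r^{1/α}(ζ)·Δx(ζ). -/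
open Filter Finset

/-- For a positive argument, `ratPow` is the usual real power. -/
lemma ratPow_natCast_of_pos (m n : ℕ) {t : ℝ} (ht : 0 < t) :
    ratPow m n t = t ^ ((m : ℝ) / n) := by
  rw [ratPow, oddRoot, if_neg ht.not_gt, zpow_natCast, ← Real.rpow_natCast,
    ← Real.rpow_mul ht.le, inv_mul_eq_div]

/-- A sequence on `ℤ` whose forward difference is nonnegative from `N` on is bounded below by its
value at `N`. -/
lemma le_of_fwd_nonneg_s14 {f : ℤ → ℝ} {N : ℤ} (h : ∀ ζ ≥ N, 0 ≤ fwd f ζ) :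
    ∀ ζ ≥ N, f N ≤ f ζ := by
  intro ζ hζ
  induction ζ, hζ using Int.leInduction with
  | base => exact le_rfl
  | succ k hk ih =>
    have := h k hk
    rw [fwd] at this
    linarith

/-- A sequence on `ℤ` whose forward difference is nonpositive from `N` on is bounded above by its
value at `N`. -/
lemma le_of_fwd_nonpos_s14 {f : ℤ → ℝ} {N : ℤ} (h : ∀ ζ ≥ N, fwd f ζ ≤ 0) :
    ∀ ζ ≥ N, f ζ ≤ f N := by
  intro ζ hζ
  have hneg : ∀ ξ ≥ N, 0 ≤ fwd (fun t => -f t) ξ := by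
    intro ξ hξ
    have := h ξ hξ
    rw [fwd] at this ⊢
    linarith
  exact neg_le_neg_iff.mp (le_of_fwd_nonneg_s14 hneg ζ hζ)

/-- The tail sums `theta` tend to zero. -/
lemma tendsto_theta (α : ℝ) (r : ℤ → ℝ) (ζ₀ : ℤ) :
    Tendsto (fun j : ℕ => theta α r (ζ₀ + j)) atTop (nhds 0) := by
  have h := tendsto_sum_nat_add (fun k : ℕ => (r (ζ₀ + k) ^ α⁻¹)⁻¹)
  refine h.congr fun j => tsum_congr fun k => ?_
  have e : ζ₀ + ((k + j : ℕ) : ℤ) = ζ₀ + j + k := by push_cast; ring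
  rw [e]

/-- Suppose `θ(ζ₀) < ∞`. If `x` is an eventually positive solution of
(1.1') with `Δx(ζ) > 0` eventually, then eventually
`x(ζ-σ+1) ≥ θ(ζ)·r^{1/α}(ζ)·Δx(ζ)`. -/
theorem statement14
    (m n : ℕ) (α : ℝ) (hm : Odd m) (hn : Odd n) (hmn : Nat.Coprime m n)
    (hm0 : 0 < m) (hn0 : 0 < n) (hα : α = (m : ℝ) / n)
    (ζ₀ σ : ℤ) (hσ : 1 ≤ σ)
    (r q : ℤ → ℝ) (hr : ∀ ζ, 0 < r ζ) (hq : ∀ ζ, 0 ≤ q ζ)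
    (hq0 : ∀ N : ℤ, ∃ ζ ≥ N, q ζ ≠ 0)
    (hθ : Summable (fun k : ℕ => (r (ζ₀ + k) ^ α⁻¹)⁻¹))
    (x : ℤ → ℝ)
    (hsol : ∀ ζ ≥ ζ₀, fwd (fun t => r t * ratPow m n (fwd x t)) ζ
        + q ζ * ratPow m n (x (ζ - σ + 1)) = 0)
    (hpos : EvPos x)
    (hinc : ∃ N : ℤ, ∀ ζ ≥ N, 0 < fwd x ζ) :
    ∃ N : ℤ, ∀ ζ ≥ N, x (ζ - σ + 1) ≥ theta α r ζ * r ζ ^ α⁻¹ * fwd x ζ := by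
  obtain ⟨N₁, hN₁⟩ := hpos
  obtain ⟨N₂, hN₂⟩ := hinc
  have hα0 : 0 < α := by rw [hα]; positivity
  set M : ℤ := max ζ₀ (max (N₁ + σ) N₂)
  have hMζ₀ : ζ₀ ≤ M := le_max_left _ _
  have hMN₁ : N₁ + σ ≤ M := (le_max_left _ _).trans (le_max_right _ _)
  have hMN₂ : N₂ ≤ M := (le_max_right _ _).trans (le_max_right _ _)
  set C : ℝ := r M * ratPow m n (fwd x M)
  have hflux : ∀ ζ ≥ M, r ζ * ratPow m n (fwd x ζ) ≤ C := by
    refine le_of_fwd_nonpos_s14 (f := fun t => r t * ratPow m n (fwd x t)) fun ζ hζ => ?_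
    have hx : 0 < x (ζ - σ + 1) := hN₁ _ (by lia)
    have hnonneg : 0 ≤ q ζ * ratPow m n (x (ζ - σ + 1)) := by
      rw [ratPow_natCast_of_pos m n hx]
      exact mul_nonneg (hq ζ) (Real.rpow_nonneg hx.le _)
    linarith [hsol ζ (hMζ₀.trans hζ)]
  have hbound : ∀ ζ ≥ M, r ζ ^ α⁻¹ * fwd x ζ ≤ C ^ α⁻¹ := by
    intro ζ hζ
    have hd : 0 < fwd x ζ := hN₂ ζ (hMN₂.trans hζ)
    have h := hflux ζ hζ
    rw [ratPow_natCast_of_pos m n hd, ← hα] at h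
    have hpow := Real.rpow_le_rpow
      (mul_nonneg (hr ζ).le (Real.rpow_nonneg hd.le α)) h (inv_nonneg.mpr hα0.le)
    rwa [Real.mul_rpow (hr ζ).le (Real.rpow_nonneg hd.le α),
      Real.rpow_rpow_inv hd.le hα0.ne'] at hpow
  have hxlow : ∀ ζ ≥ M, x M ≤ x ζ :=
    le_of_fwd_nonneg_s14 fun ζ hζ => (hN₂ ζ (hMN₂.trans hζ)).le
  have hxM : 0 < x M := hN₁ M (by lia)
  have hlim : Tendsto (fun j : ℕ => theta α r (ζ₀ + j) * C ^ α⁻¹) atTop (nhds 0) := by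
    simpa using (tendsto_theta α r ζ₀).mul_const (C ^ α⁻¹)
  obtain ⟨J, hJ⟩ := eventually_atTop.mp (hlim.eventually_le_const hxM)
  refine ⟨max (ζ₀ + J) (M + σ), fun ζ hζ => ?_⟩
  have hζJ : ζ₀ + J ≤ ζ := (le_max_left _ _).trans hζ
  have hζM : M + σ ≤ ζ := (le_max_right _ _).trans hζ
  obtain ⟨j, rfl⟩ : ∃ j : ℕ, ζ = ζ₀ + j := ⟨(ζ - ζ₀).toNat, by lia⟩
  have hθ0 : 0 ≤ theta α r (ζ₀ + j) :=
    tsum_nonneg fun k => inv_nonneg.mpr (Real.rpow_nonneg (hr _).le _)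
  calc theta α r (ζ₀ + j) * r (ζ₀ + j) ^ α⁻¹ * fwd x (ζ₀ + j)
      = theta α r (ζ₀ + j) * (r (ζ₀ + j) ^ α⁻¹ * fwd x (ζ₀ + j)) := mul_assoc _ _ _
    _ ≤ theta α r (ζ₀ + j) * C ^ α⁻¹ :=
        mul_le_mul_of_nonneg_left (hbound _ (by lia)) hθ0
    _ ≤ x M := hJ j (by lia)
    _ ≤ x (ζ₀ + j - σ + 1) := hxlow _ (by lia)
end

section
/- Let {r(ζ)} be a sequence of positive reals with θ(ζ) = ∑_{s=ζ}^∞ r(s)^{−1/α} < ∞ and θ(ζ) > 0 for all ζ. Then for every real sequence {x(ζ)} and every ζ, the identity (1/θ(ζ+1)) · Δ( θ(ζ)·θ(ζ+1)·r^{1/α}(ζ)·Δ( x(ζ)/θ(ζ) ) ) = Δ( r^{1/α}(ζ)·Δx(ζ) ) holds, where Δ is the forward difference operator Δy(ζ) = y(ζ+1) − y(ζ). -/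
open Filter Finset

/-- Splitting off the first term of the tail sum: `θ(ζ) = r(ζ)^{-1/α} + θ(ζ+1)`. -/
theorem theta_eq_add_theta_succ {α : ℝ} {r : ℤ → ℝ} {ζ : ℤ}
    (h : Summable (fun k : ℕ => (r (ζ + k) ^ α⁻¹)⁻¹)) :
    theta α r ζ = (r ζ ^ α⁻¹)⁻¹ + theta α r (ζ + 1) := by
  unfold theta
  rw [h.tsum_eq_zero_add]
  simp [add_assoc, add_comm (1 : ℤ)]

/-- If `r` is positive with `θ(ζ) < ∞` and `θ(ζ) > 0` for all `ζ`,
then for every real sequence `x` and every `ζ`,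
`(1/θ(ζ+1))·Δ(θ(ζ)θ(ζ+1)r^{1/α}(ζ)·Δ(x(ζ)/θ(ζ))) = Δ(r^{1/α}(ζ)·Δx(ζ))`. -/
theorem statement16
    (m n : ℕ) (α : ℝ) (hm : Odd m) (hn : Odd n) (hmn : Nat.Coprime m n)
    (hm0 : 0 < m) (hn0 : 0 < n) (hα : α = (m : ℝ) / n)
    (r : ℤ → ℝ) (hr : ∀ ζ, 0 < r ζ)
    (hθ : ∀ ζ : ℤ, Summable (fun k : ℕ => (r (ζ + k) ^ α⁻¹)⁻¹))
    (hθpos : ∀ ζ : ℤ, 0 < theta α r ζ) :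
    ∀ (x : ℤ → ℝ) (ζ : ℤ),
      (theta α r (ζ + 1))⁻¹ *
        fwd (fun t => theta α r t * theta α r (t + 1) * r t ^ α⁻¹ *
          fwd (fun s => x s / theta α r s) t) ζ
      = fwd (fun t => r t ^ α⁻¹ * fwd x t) ζ := by
  intro x ζ
  have hfwd (t : ℤ) : theta α r t * theta α r (t + 1) * r t ^ α⁻¹ *
      fwd (fun s => x s / theta α r s) t =
        r t ^ α⁻¹ * (x (t + 1) * theta α r t - x t * theta α r (t + 1)) := by
    have h₀ := (hθpos t).ne'
    have h₁ := (hθpos (t + 1)).ne'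
    simp only [fwd]
    field_simp
  have hR (t : ℤ) : r t ^ α⁻¹ * theta α r t = 1 + r t ^ α⁻¹ * theta α r (t + 1) := by
    rw [theta_eq_add_theta_succ (hθ t), mul_add,
      mul_inv_cancel₀ (Real.rpow_pos_of_pos (hr t) _).ne']
  rw [inv_mul_eq_iff_eq_mul₀ (hθpos (ζ + 1)).ne']
  unfold fwd at hfwd ⊢
  simp only [hfwd]
  linear_combination x (ζ + 1) * hR (ζ + 1) - x (ζ + 1) * hR ζ
end
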